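/- arXiv:2409.08061 — 2 statements merged into one kernel-verified Lean document; each statement's English description precedes it below -/
import Mathlib

section
/- Under the standing assumptions, there exist γ > 0 and C > 0 such that (i) ∫_ℝ |s|^γ dσ(s) < ∞, and (ii) for every r > 0, sup_{s∈ℝ} σ([s − r, s + r]) ≤ C r^γ. -/
open MeasureTheory Filter Topology

/-- The group of orientation-preserving affine maps of ℝ, modeled as pairs `(r, b)`
with `r > 0`, acting by `t ↦ r * t + b`. -/
abbrev AffP : Type := {p : ℝ × ℝ // 0 < p.1}

/-- The topological support of a measure. -/
def msupport {α : Type*} [TopologicalSpace α] [MeasurableSpace α] (μ : Measure α) : Set α :=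
  {x | ∀ U : Set α, IsOpen U → x ∈ U → 0 < μ U}

lemma forall_msupport_of_ae {lam : Measure AffP} {t : ℝ}
    (h : ∀ᵐ φ ∂lam, φ.1.1 * t + φ.1.2 = t) : ∀ φ ∈ msupport lam, φ.1.1 * t + φ.1.2 = t := by
  intro φ hφ
  by_contra hne
  have hopen : IsOpen {ψ : AffP | ψ.1.1 * t + ψ.1.2 ≠ t} :=
    isOpen_ne_fun (by fun_prop) continuous_const
  exact (hφ _ hopen hne).ne' (ae_iff.1 h)

/-- The measure `σ` is stationary under the random affine map with law `lam`. -/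
def IsAffStationary (lam : Measure AffP) (σ : Measure ℝ) : Prop :=
  ∀ A : Set ℝ, MeasurableSet A →
    σ A = ∫⁻ φ : AffP, σ ((fun t => φ.1.1 * t + φ.1.2) ⁻¹' A) ∂lam

/-- The largest mass that `σ` gives to an interval of radius `t`. -/
noncomputable def concentration (σ : Measure ℝ) (t : ℝ) : ENNReal :=
  ⨆ y : ℝ, σ (Set.Icc (y - t) (y + t))

section Stationary

variable {lam : Measure AffP} {σ : Measure ℝ}

lemma IsAffStationary.eq_map [SFinite lam] [SFinite σ] (h : IsAffStationary lam σ) :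
    σ = (lam.prod σ).map (fun p => p.1.1.1 * p.2 + p.1.1.2) := by
  have hm : Measurable (fun p : AffP × ℝ => p.1.1.1 * p.2 + p.1.1.2) := by fun_prop
  ext A hA
  rw [Measure.map_apply hm hA, Measure.prod_apply (hm hA), h A hA]
  rfl

lemma IsAffStationary.lintegral_eq [SFinite lam] [SFinite σ] (h : IsAffStationary lam σ)
    {g : ℝ → ENNReal} (hg : Measurable g) :
    ∫⁻ x, g x ∂σ = ∫⁻ x, ∫⁻ φ : AffP, g (φ.1.1 * x + φ.1.2) ∂lam ∂σ := by
  have hm : Measurable (fun p : AffP × ℝ => p.1.1.1 * p.2 + p.1.1.2) := by fun_prop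
  conv_lhs => rw [h.eq_map, lintegral_map hg hm]
  exact lintegral_prod_symm _ (hg.comp hm).aemeasurable

lemma preimage_affine_Icc (φ : AffP) (y t : ℝ) :
    (fun x => φ.1.1 * x + φ.1.2) ⁻¹' Set.Icc (y - t) (y + t) =
      Set.Icc ((y - φ.1.2) / φ.1.1 - t / φ.1.1) ((y - φ.1.2) / φ.1.1 + t / φ.1.1) := by
  have hr := φ.2
  ext x
  simp only [Set.mem_preimage, Set.mem_Icc]
  rw [← sub_div, ← add_div, div_le_iff₀ hr, le_div_iff₀ hr]
  constructor <;> rintro ⟨h1, h2⟩ <;> constructor <;> linarith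

lemma IsAffStationary.measure_Icc (h : IsAffStationary lam σ) (y t : ℝ) :
    σ (Set.Icc (y - t) (y + t)) =
      ∫⁻ φ : AffP, σ (Set.Icc ((y - φ.1.2) / φ.1.1 - t / φ.1.1)
        ((y - φ.1.2) / φ.1.1 + t / φ.1.1)) ∂lam := by
  rw [h _ measurableSet_Icc]
  simp_rw [preimage_affine_Icc]

lemma IsAffStationary.measure_singleton (h : IsAffStationary lam σ) (y : ℝ) :
    σ {y} = ∫⁻ φ : AffP, σ {(y - φ.1.2) / φ.1.1} ∂lam := by
  simpa using h.measure_Icc y 0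

lemma measurable_measure_Icc (σ : Measure ℝ) [SFinite σ] :
    Measurable (fun p : ℝ × ℝ => σ (Set.Icc (p.1 - p.2) (p.1 + p.2))) := by
  have hs : MeasurableSet {q : (ℝ × ℝ) × ℝ | q.1.1 - q.1.2 ≤ q.2 ∧ q.2 ≤ q.1.1 + q.1.2} :=
    .inter (measurableSet_le (by fun_prop : Measurable fun q : (ℝ × ℝ) × ℝ => q.1.1 - q.1.2)
        measurable_snd)
      (measurableSet_le measurable_snd
        (by fun_prop : Measurable fun q : (ℝ × ℝ) × ℝ => q.1.1 + q.1.2))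
  exact measurable_measure_prodMk_left hs

lemma IsAffStationary.measure_singleton_eq_zero [IsProbabilityMeasure lam] [IsProbabilityMeasure σ]
    (h : IsAffStationary lam σ)
    (hnofix : ¬ ∃ t : ℝ, ∀ φ ∈ msupport lam, φ.1.1 * t + φ.1.2 = t) (x : ℝ) : σ {x} = 0 := by
  by_contra hx
  have hfin : ∀ c : ENNReal, c ≠ 0 → {y : ℝ | c ≤ σ {y}}.Finite := fun c hc =>
    Measure.finite_const_le_meas_of_disjoint_iUnion σ (pos_iff_ne_zero.2 hc)
      (fun y => measurableSet_singleton y)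
      (fun y z hyz => by simpa using hyz) (measure_ne_top _ _)
  obtain ⟨x₁, hx₁, hmax⟩ := (hfin _ hx).exists_maximalFor (fun y => σ {y}) _ ⟨x, le_refl (σ {x})⟩
  set m := σ {x₁} with hm
  have hm0 : m ≠ 0 := fun h0 => hx (le_antisymm (hx₁.trans h0.le) bot_le)
  have hle : ∀ y, σ {y} ≤ m := by
    intro y
    rcases le_total (σ {x}) (σ {y}) with hy | hy
    · rcases le_total (σ {y}) m with h' | h'
      · exact h'
      · exact hmax hy h'
    · exact hy.trans hx₁
  set B := {y : ℝ | m ≤ σ {y}} with hB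
  have hBf : B.Finite := hfin m hm0
  have hmeas : Measurable (fun y : ℝ => σ {y}) := by
    have := (measurable_measure_Icc σ).comp (f := fun y : ℝ => (y, (0 : ℝ))) (by fun_prop)
    simpa [Function.comp_def] using this
  have key : ∀ y ∈ B, ∀ᵐ φ ∂lam, (y - φ.1.2) / φ.1.1 ∈ B := by
    intro y hy
    have h1 : ∫⁻ φ : AffP, σ {(y - φ.1.2) / φ.1.1} ∂lam = ∫⁻ _ : AffP, m ∂lam := by
      rw [← h.measure_singleton, lintegral_const, measure_univ, mul_one]
      exact le_antisymm (hle y) hy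
    have h2 := ae_eq_of_ae_le_of_lintegral_le (μ := lam)
      (f := fun φ : AffP => σ {(y - φ.1.2) / φ.1.1}) (g := fun _ => m)
      (Eventually.of_forall fun φ => hle _) (by rw [h1]; simp [m]) (by fun_prop) h1.ge
    filter_upwards [h2] with φ hφ
    exact hφ.ge
  have hall : ∀ᵐ φ ∂lam, ∀ y ∈ B, (y - φ.1.2) / φ.1.1 ∈ B :=
    (ae_ball_iff hBf.countable).2 key
  obtain ⟨z, hz, hzmax⟩ := hBf.exists_maximalFor id _ ⟨x₁, le_refl m⟩
  have hzle : ∀ w ∈ B, w ≤ z := fun w hw => by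
    rcases le_total w z with h' | h'
    · exact h'
    · exact hzmax hw h'
  refine hnofix ⟨z, forall_msupport_of_ae ?_⟩
  filter_upwards [hall] with φ hφ
  have hr := φ.2
  have hinj : Set.InjOn (fun y : ℝ => (y - φ.1.2) / φ.1.1) B := by
    intro a _ b _ hab
    have := (div_left_inj' hr.ne').1 hab
    linarith
  obtain ⟨w, hw, hwz⟩ := ((hBf.injOn_iff_bijOn_of_mapsTo hφ).1 hinj).surjOn hz
  have h1 := hzle _ (hφ z hz)
  have h2 := hzle w hw
  rw [div_le_iff₀ hr] at h1
  simp only at hwz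
  rw [div_eq_iff hr.ne'] at hwz
  nlinarith

lemma exists_radius_measure_Icc_le [IsFiniteMeasure σ] (hσ : ∀ x, σ {x} = 0) {c : ENNReal}
    (hc : 0 < c) : ∃ δ > 0, ∀ y, σ (Set.Icc (y - δ) (y + δ)) ≤ c := by
  have htight : ∃ M : ℝ, σ (Set.Icc (-M) M)ᶜ < c := by
    have h1 : Tendsto (fun M : ℝ => σ (Set.Icc (-M) M)ᶜ) atTop (𝓝 (σ (⋂ M : ℝ, (Set.Icc (-M) M)ᶜ))) := by
      refine tendsto_measure_iInter_atTop (fun M => measurableSet_Icc.compl.nullMeasurableSet) ?_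
        ⟨0, measure_ne_top _ _⟩
      intro a b hab
      exact Set.compl_subset_compl.2 (Set.Icc_subset_Icc (neg_le_neg hab) hab)
    have h2 : (⋂ M : ℝ, (Set.Icc (-M) M)ᶜ) = ∅ := by
      ext x
      simp only [Set.mem_iInter, Set.mem_compl_iff, Set.mem_empty_iff_false, iff_false, not_forall,
        not_not]
      exact ⟨|x|, neg_abs_le x, le_abs_self x⟩
    rw [h2, measure_empty] at h1
    exact (h1.eventually_lt_const hc).exists
  obtain ⟨M, hM⟩ := htight
  have hloc : ∀ x : ℝ, ∃ δ > 0, σ (Metric.ball x δ) < c := by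
    intro x
    have h1 : Tendsto (fun δ : ℝ => σ (Metric.closedBall x δ)) (𝓝[>] 0) (𝓝 (σ {x})) := by
      have := tendsto_measure_biInter_gt (μ := σ) (s := fun δ : ℝ => Metric.closedBall x δ) (a := 0)
        (fun r _ => measurableSet_closedBall.nullMeasurableSet)
        (fun i j _ hij => Metric.closedBall_subset_closedBall hij) ⟨1, one_pos, measure_ne_top _ _⟩
      rwa [Metric.biInter_gt_closedBall, Metric.closedBall_zero] at this
    rw [hσ] at h1
    obtain ⟨δ, hδ, hδ0⟩ := ((h1.eventually_lt_const hc).and self_mem_nhdsWithin).exists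
    exact ⟨δ, hδ0, (measure_mono Metric.ball_subset_closedBall).trans_lt hδ⟩
  choose d hd0 hd using hloc
  obtain ⟨δ, hδ, hL⟩ := lebesgue_number_lemma_of_metric (isCompact_Icc (a := -M - 1) (b := M + 1))
    (c := fun x : ℝ => Metric.ball x (d x)) (fun x => Metric.isOpen_ball)
    (fun x _ => Set.mem_iUnion.2 ⟨x, Metric.mem_ball_self (hd0 x)⟩)
  refine ⟨min (δ / 2) 1, by positivity, fun y => ?_⟩
  by_cases hy : y ∈ Set.Icc (-M - 1) (M + 1)
  · obtain ⟨x, hx⟩ := hL y hy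
    refine (measure_mono (Set.Subset.trans ?_ hx)).trans (hd x).le
    rw [← Real.closedBall_eq_Icc]
    exact Metric.closedBall_subset_ball ((min_le_left _ _).trans_lt (by linarith))
  · refine (measure_mono ?_).trans hM.le
    intro s hs hs'
    have := min_le_right (δ / 2) 1
    exact hy ⟨by linarith [hs.1, hs.2, hs'.1, hs'.2], by linarith [hs.1, hs.2, hs'.1, hs'.2]⟩

end Stationary

section Monotone

open Set

lemma tendsto_intervalIntegral_shift_of_monotone {f : ℝ → ℝ} (hf : Monotone f) {l : ℝ}
    {L : Filter ℝ} {y : ℝ} (h0 : Tendsto f L (𝓝 l)) (h1 : Tendsto (fun s => f (s + y)) L (𝓝 l))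
    (hy : 0 ≤ y) : Tendsto (fun s => ∫ u in s..s + y, f u) L (𝓝 (y * l)) := by
  have hintg : ∀ a b, IntervalIntegrable f volume a b := fun a b => hf.intervalIntegrable
  refine tendsto_of_tendsto_of_tendsto_of_le_of_le (h0.const_mul y) (h1.const_mul y) ?_ ?_
  · intro s
    have := intervalIntegral.integral_mono_on (a := s) (b := s + y) (by linarith)
      intervalIntegrable_const (hintg _ _) (f := fun _ => f s) (fun u hu => hf hu.1)
    simpa using this
  · intro s
    have := intervalIntegral.integral_mono_on (a := s) (b := s + y) (by linarith)
      (hintg _ _) intervalIntegrable_const (g := fun _ => f (s + y)) (fun u hu => hf hu.2)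
    simpa using this

lemma integrable_shift_sub_of_monotone_of_nonneg {f : ℝ → ℝ} (hf : Monotone f)
    (h0 : Tendsto f atBot (𝓝 0)) (h1 : Tendsto f atTop (𝓝 1)) {y : ℝ} (hy : 0 ≤ y) :
    Integrable (fun s => f (s + y) - f s) ∧ ∫ s, (f (s + y) - f s) = y := by
  have hintg : ∀ a b, IntervalIntegrable f volume a b := fun a b => hf.intervalIntegrable
  have hfy : Monotone (fun s => f (s + y)) := fun a b hab => hf (by linarith)
  have hintg' : ∀ a b, IntervalIntegrable (fun s => f (s + y)) volume a b :=
    fun a b => hfy.intervalIntegrable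
  have hnn : ∀ s, 0 ≤ f (s + y) - f s := fun s => sub_nonneg.2 (hf (by linarith))
  have hlim : Tendsto (fun N : ℝ => ∫ s in (-N)..N, (f (s + y) - f s)) atTop (𝓝 y) := by
    have e : ∀ N : ℝ, ∫ s in (-N)..N, (f (s + y) - f s) =
        (∫ u in N..N + y, f u) - ∫ u in (-N)..(-N + y), f u := by
      intro N
      rw [intervalIntegral.integral_sub (hintg' _ _) (hintg _ _),
        intervalIntegral.integral_comp_add_right (fun u => f u) y,
        ← intervalIntegral.integral_add_adjacent_intervals (hintg (-N + y) N) (hintg N (N + y)),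
        ← intervalIntegral.integral_add_adjacent_intervals (hintg (-N) (-N + y)) (hintg (-N + y) N)]
      ring
    simp_rw [e]
    have t1 := tendsto_intervalIntegral_shift_of_monotone hf h1
      (h1.comp (tendsto_atTop_add_const_right _ y tendsto_id)) hy
    have t0 := tendsto_intervalIntegral_shift_of_monotone hf h0
      (h0.comp (tendsto_atBot_add_const_right _ y tendsto_id)) hy
    simpa using t1.sub (t0.comp tendsto_neg_atTop_atBot)
  have hI : Integrable (fun s => f (s + y) - f s) := by
    refine integrable_of_intervalIntegral_norm_tendsto (a := fun N : ℝ => -N) (b := id) (l := atTop)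
      y (fun N => ?_) tendsto_neg_atTop_atBot tendsto_id ?_
    · by_cases h : -N ≤ N
      · exact (intervalIntegrable_iff_integrableOn_Ioc_of_le h).1 ((hintg' _ _).sub (hintg _ _))
      · rw [id, Ioc_eq_empty (fun h' => h h'.le)]
        exact integrableOn_empty
    · simpa [Real.norm_of_nonneg (hnn _)] using hlim
  exact ⟨hI, tendsto_nhds_unique
    (intervalIntegral_tendsto_integral hI tendsto_neg_atTop_atBot tendsto_id) hlim⟩

lemma integrable_shift_sub_of_monotone {f : ℝ → ℝ} (hf : Monotone f)
    (h0 : Tendsto f atBot (𝓝 0)) (h1 : Tendsto f atTop (𝓝 1)) (y : ℝ) :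
    Integrable (fun s => f (s + y) - f s) ∧ ∫ s, (f (s + y) - f s) = y := by
  rcases le_total 0 y with hy | hy
  · exact integrable_shift_sub_of_monotone_of_nonneg hf h0 h1 hy
  · obtain ⟨hI, hv⟩ := integrable_shift_sub_of_monotone_of_nonneg hf h0 h1 (neg_nonneg.2 hy)
    have e : (fun s => f (s + y) - f s) =
        fun s => -((fun u => f (u + -y) - f u) (s + y)) := by
      ext s
      simp
    refine ⟨e ▸ (hI.comp_add_right y).neg, ?_⟩
    rw [e, integral_neg, integral_add_right_eq_self (fun u => f (u + -y) - f u) y, hv, neg_neg]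

lemma integral_abs_shift_sub_of_monotone {f : ℝ → ℝ} (hf : Monotone f)
    (h0 : Tendsto f atBot (𝓝 0)) (h1 : Tendsto f atTop (𝓝 1)) (y : ℝ) :
    ∫ s, |f (s + y) - f s| = |y| := by
  rcases le_total 0 y with hy | hy
  · have : ∀ s, |f (s + y) - f s| = f (s + y) - f s := fun s =>
      abs_of_nonneg (sub_nonneg.2 (hf (by linarith)))
    simp_rw [this]
    rw [(integrable_shift_sub_of_monotone hf h0 h1 y).2, abs_of_nonneg hy]
  · have : ∀ s, |f (s + y) - f s| = -(f (s + y) - f s) := fun s =>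
      abs_of_nonpos (sub_nonpos.2 (hf (by linarith)))
    simp_rw [this]
    rw [integral_neg, (integrable_shift_sub_of_monotone hf h0 h1 y).2, abs_of_nonpos hy]

variable {Ω : Type*} [MeasurableSpace Ω] {μ : Measure Ω}

lemma integrable_prod_shift_sub_of_monotone [SFinite μ] {f : ℝ → ℝ}
    (hf : Monotone f) (h0 : Tendsto f atBot (𝓝 0)) (h1 : Tendsto f atTop (𝓝 1))
    {Y : Ω → ℝ} (hYm : Measurable Y) (hY : Integrable Y μ) :
    Integrable (fun p : Ω × ℝ => f (p.2 + Y p.1) - f p.2) (μ.prod volume) := by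
  have hfm := hf.measurable
  rw [integrable_prod_iff (by fun_prop)]
  refine ⟨Eventually.of_forall fun ω => (integrable_shift_sub_of_monotone hf h0 h1 (Y ω)).1, ?_⟩
  simp only [Real.norm_eq_abs]
  simp_rw [integral_abs_shift_sub_of_monotone hf h0 h1]
  exact hY.abs

/-- A bounded monotone profile that is subharmonic for a random walk forces a positive drift,
unless the walk does not move. -/
lemma ae_eq_zero_of_monotone_subharmonic [IsProbabilityMeasure μ] {f : ℝ → ℝ}
    (hf : Monotone f) (h0 : Tendsto f atBot (𝓝 0)) (h1 : Tendsto f atTop (𝓝 1))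
    {Y : Ω → ℝ} (hYm : Measurable Y) (hY : Integrable Y μ)
    (hsub : ∀ s, f s ≤ ∫ ω, f (s + Y ω) ∂μ) (hdrift : ∫ ω, Y ω ∂μ ≤ 0) :
    ∀ᵐ ω ∂μ, Y ω = 0 := by
  have hfm := hf.measurable
  have hnn : ∀ s, 0 ≤ f s := fun s => hf.le_of_tendsto h0 s
  have hle : ∀ s, f s ≤ 1 := fun s => hf.ge_of_tendsto h1 s
  have hf2 : Monotone (fun s => f s ^ 2) := fun a b hab => pow_le_pow_left₀ (hnn a) (hf hab) 2
  have h02 : Tendsto (fun s => f s ^ 2) atBot (𝓝 0) := by simpa using h0.pow 2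
  have h12 : Tendsto (fun s => f s ^ 2) atTop (𝓝 1) := by simpa using h1.pow 2
  have I1 := integrable_prod_shift_sub_of_monotone hf h0 h1 hYm hY
  have I2 := integrable_prod_shift_sub_of_monotone hf2 h02 h12 hYm hY
  have I3 : Integrable (fun p : Ω × ℝ => f p.2 * (f (p.2 + Y p.1) - f p.2)) (μ.prod volume) := by
    refine I1.bdd_mul (c := 1) (hfm.comp measurable_snd).aestronglyMeasurable (Eventually.of_forall fun p => ?_)
    rw [Real.norm_of_nonneg (hnn _)]
    exact hle _
  have e : ∀ p : Ω × ℝ, (f (p.2 + Y p.1) - f p.2) ^ 2 =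
      (f (p.2 + Y p.1) ^ 2 - f p.2 ^ 2) - 2 * (f p.2 * (f (p.2 + Y p.1) - f p.2)) := by
    intro p
    ring
  have I4 : Integrable (fun p : Ω × ℝ => (f (p.2 + Y p.1) - f p.2) ^ 2) (μ.prod volume) := by
    simp_rw [e]
    exact I2.sub (I3.const_mul 2)
  have v2 : ∫ p : Ω × ℝ, (f (p.2 + Y p.1) ^ 2 - f p.2 ^ 2) ∂(μ.prod volume) = ∫ ω, Y ω ∂μ := by
    rw [integral_prod _ I2]
    exact integral_congr_ae (Eventually.of_forall fun ω =>
      (integrable_shift_sub_of_monotone hf2 h02 h12 (Y ω)).2)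
  have v3 : 0 ≤ ∫ p : Ω × ℝ, f p.2 * (f (p.2 + Y p.1) - f p.2) ∂(μ.prod volume) := by
    rw [integral_prod_symm _ I3]
    refine integral_nonneg fun s => ?_
    have hi : Integrable (fun ω => f (s + Y ω)) μ :=
      Integrable.of_bound (by fun_prop : Measurable _).aestronglyMeasurable 1 (Eventually.of_forall fun ω => by
        rw [Real.norm_of_nonneg (hnn _)]
        exact hle _)
    simp only [Pi.zero_apply]
    rw [integral_const_mul, integral_sub hi (integrable_const _), integral_const]
    have := hsub s
    simp only [probReal_univ, smul_eq_mul, one_mul]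
    exact mul_nonneg (hnn s) (by linarith)
  have v4 : ∫ p : Ω × ℝ, (f (p.2 + Y p.1) - f p.2) ^ 2 ∂(μ.prod volume) = 0 := by
    refine le_antisymm ?_ (integral_nonneg fun p => sq_nonneg _)
    simp_rw [e]
    rw [integral_sub I2 (I3.const_mul 2), integral_const_mul, v2]
    linarith
  rw [integral_eq_zero_iff_of_nonneg (fun p => sq_nonneg _) I4] at v4
  filter_upwards [Measure.ae_ae_of_ae_prod v4] with ω hω
  rw [← (integrable_shift_sub_of_monotone hf h0 h1 (Y ω)).2]
  refine integral_eq_zero_of_ae ?_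
  filter_upwards [hω] with s hs
  simpa using hs

end Monotone

section Drift

variable {lam : Measure AffP} {σ : Measure ℝ}

lemma ae_eq_zero_of_conv_eq_self {ν : Measure ℝ} [IsProbabilityMeasure σ] [IsProbabilityMeasure ν]
    (h : σ ∗ ν = σ) : ∀ᵐ x ∂ν, x = 0 := by
  have hone : ∀ᶠ t in 𝓝 (0 : ℝ), charFun ν t = 1 := by
    have hne : ∀ᶠ t in 𝓝 (0 : ℝ), charFun σ t ≠ 0 :=
      continuous_charFun.continuousAt.eventually_ne (by simp)
    filter_upwards [hne] with t ht
    have := charFun_conv (μ := σ) (ν := ν) t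
    rw [h] at this
    exact (mul_right_eq_self₀.1 this.symm).resolve_right ht
  have hcos : ∀ t, charFun ν t = 1 → ∀ᵐ x ∂ν, Real.cos (t * x) = 1 := by
    intro t ht
    have hi : Integrable (fun x : ℝ => Complex.exp (t * x * Complex.I)) ν :=
      Integrable.of_bound (by fun_prop) 1 (Eventually.of_forall fun x => by
        rw [← Complex.ofReal_mul, Complex.norm_exp_ofReal_mul_I])
    have hre : ∫ x, Real.cos (t * x) ∂ν = 1 := by
      rw [charFun_apply_real] at ht
      have h1 := congrArg Complex.re ht
      rw [← RCLike.re_eq_complex_re, ← integral_re hi] at h1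
      simp only [RCLike.re_eq_complex_re, ← Complex.ofReal_mul, Complex.exp_ofReal_mul_I_re] at h1
      simpa using h1
    have hci : Integrable (fun x : ℝ => Real.cos (t * x)) ν :=
      Integrable.of_bound (by fun_prop) 1 (Eventually.of_forall fun x => Real.abs_cos_le_one _)
    have h0 : ∫ x, (1 - Real.cos (t * x)) ∂ν = 0 := by
      rw [integral_sub (integrable_const _) hci, hre]
      simp
    rw [integral_eq_zero_iff_of_nonneg (fun x => sub_nonneg.2 (Real.cos_le_one _))
      ((integrable_const _).sub hci)] at h0
    filter_upwards [h0] with x hx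
    exact (sub_eq_zero.1 hx).symm
  have hlim : Tendsto (fun n : ℕ => 1 / ((n : ℝ) + 1)) atTop (𝓝 0) :=
    tendsto_one_div_add_atTop_nhds_zero_nat
  obtain ⟨N, hN⟩ := eventually_atTop.1 (hlim.eventually hone)
  have hall : ∀ᵐ x ∂ν, ∀ n : ℕ, N ≤ n → Real.cos (1 / ((n : ℝ) + 1) * x) = 1 :=
    ae_all_iff.2 fun n => by
      by_cases hn : N ≤ n
      · filter_upwards [hcos _ (hN n hn)] with x hx _ using hx
      · exact Eventually.of_forall fun x h' => absurd h' hn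
  filter_upwards [hall] with x hx
  have hx0 : Tendsto (fun n : ℕ => 1 / ((n : ℝ) + 1) * x) atTop (𝓝 0) := by
    simpa using hlim.mul_const x
  have hpi := Real.pi_pos
  have hev := (hx0.eventually (Ioo_mem_nhds (by linarith : -(2 * Real.pi) < 0)
    (by linarith : (0 : ℝ) < 2 * Real.pi))).and (eventually_ge_atTop N)
  obtain ⟨n, hn, hNn⟩ := hev.exists
  have := (Real.cos_eq_one_iff_of_lt_of_lt hn.1 hn.2).1 (hx n hNn)
  have hpos : 1 / ((n : ℝ) + 1) ≠ 0 := by positivity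
  exact (mul_eq_zero.1 this).resolve_left hpos

lemma IsAffStationary.ae_translation_eq_zero [IsProbabilityMeasure lam] [IsProbabilityMeasure σ]
    (h : IsAffStationary lam σ) (hr : ∀ᵐ φ ∂lam, φ.1.1 = 1) : ∀ᵐ φ ∂lam, φ.1.2 = 0 := by
  have hb : Measurable (fun φ : AffP => φ.1.2) := by fun_prop
  have := Measure.isProbabilityMeasure_map (μ := lam) hb.aemeasurable
  have hconv : σ ∗ lam.map (fun φ : AffP => φ.1.2) = σ := by
    ext A hA
    rw [Measure.conv_comm, ← lintegral_indicator_one hA, Measure.lintegral_conv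
      (measurable_one.indicator hA), lintegral_map (by
        refine Measurable.lintegral_prod_right' (f := fun p : ℝ × ℝ =>
          A.indicator (1 : ℝ → ENNReal) (p.1 + p.2)) ?_
        exact (measurable_one.indicator hA).comp (by fun_prop)) hb, h A hA]
    refine lintegral_congr_ae ?_
    filter_upwards [hr] with φ hφ
    rw [hφ, ← lintegral_indicator_one (by
      exact hA.preimage (by fun_prop : Measurable fun t : ℝ => 1 * t + φ.1.2))]
    refine lintegral_congr fun x => ?_
    change A.indicator (1 : ℝ → ENNReal) (φ.1.2 + x) = A.indicator 1 (1 * x + φ.1.2)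
    rw [one_mul, add_comm]
  exact ae_of_ae_map hb.aemeasurable (ae_eq_zero_of_conv_eq_self hconv)

lemma measure_Icc_le_concentration (σ : Measure ℝ) (y t : ℝ) :
    σ (Set.Icc (y - t) (y + t)) ≤ concentration σ t :=
  le_iSup (fun y => σ (Set.Icc (y - t) (y + t))) y

lemma concentration_mono (σ : Measure ℝ) : Monotone (concentration σ) := fun _ _ hst =>
  iSup_mono fun _ => measure_mono (Set.Icc_subset_Icc (by linarith) (by linarith))

lemma concentration_le_one (σ : Measure ℝ) [IsProbabilityMeasure σ] (t : ℝ) :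
    concentration σ t ≤ 1 := iSup_le fun _ => prob_le_one

lemma concentration_ne_top (σ : Measure ℝ) [IsProbabilityMeasure σ] (t : ℝ) :
    concentration σ t ≠ ⊤ := ((concentration_le_one σ t).trans_lt ENNReal.one_lt_top).ne

lemma IsAffStationary.concentration_le (h : IsAffStationary lam σ) (t : ℝ) :
    concentration σ t ≤ ∫⁻ φ : AffP, concentration σ (t / φ.1.1) ∂lam :=
  iSup_le fun y => (h.measure_Icc y t).le.trans
    (lintegral_mono fun _ => measure_Icc_le_concentration σ _ _)

lemma tendsto_concentration_zero [IsProbabilityMeasure σ] (hσ : ∀ x, σ {x} = 0) :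
    Tendsto (concentration σ) (𝓝[>] 0) (𝓝 0) := by
  refine ENNReal.tendsto_nhds_zero.2 fun c hc => ?_
  obtain ⟨δ, hδ, hle⟩ := exists_radius_measure_Icc_le hσ hc
  filter_upwards [Ioo_mem_nhdsGT hδ] with t ht
  exact (concentration_mono σ ht.2.le).trans (iSup_le hle)

lemma tendsto_measure_Icc_neg_self [IsProbabilityMeasure σ] :
    Tendsto (fun M : ℝ => σ (Set.Icc (-M) M)) atTop (𝓝 1) := by
  have h1 : Tendsto (fun M : ℝ => σ (Set.Icc (-M) M)) atTop
      (𝓝 (σ (⋃ M : ℝ, Set.Icc (-M) M))) :=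
    tendsto_measure_iUnion_atTop fun a b hab => Set.Icc_subset_Icc (neg_le_neg hab) hab
  have h2 : (⋃ M : ℝ, Set.Icc (-M) M) = Set.univ :=
    Set.eq_univ_of_forall fun x => Set.mem_iUnion.2 ⟨|x|, neg_abs_le x, le_abs_self x⟩
  rwa [h2, measure_univ] at h1

lemma tendsto_concentration_one [IsProbabilityMeasure σ] :
    Tendsto (concentration σ) atTop (𝓝 1) :=
  tendsto_of_tendsto_of_tendsto_of_le_of_le tendsto_measure_Icc_neg_self tendsto_const_nhds
    (fun M => by simpa using measure_Icc_le_concentration σ 0 M) (concentration_le_one σ)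

lemma IsAffStationary.integral_log_neg [IsProbabilityMeasure lam] [IsProbabilityMeasure σ]
    (h : IsAffStationary lam σ)
    (hnofix : ¬ ∃ t : ℝ, ∀ φ ∈ msupport lam, φ.1.1 * t + φ.1.2 = t)
    (hintg : Integrable (fun φ : AffP => Real.log φ.1.1) lam) :
    ∫ φ : AffP, Real.log φ.1.1 ∂lam < 0 := by
  by_contra! hge
  have hσ := h.measure_singleton_eq_zero hnofix
  set f : ℝ → ℝ := fun s => (concentration σ (Real.exp s)).toReal with hf
  have hmono : Monotone f := fun a b hab =>
    ENNReal.toReal_mono (concentration_ne_top σ _) (concentration_mono σ (Real.exp_le_exp.2 hab))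
  have h0 : Tendsto f atBot (𝓝 0) := by
    have := (tendsto_concentration_zero hσ).comp Real.tendsto_exp_atBot_nhdsGT
    exact (ENNReal.tendsto_toReal ENNReal.zero_ne_top).comp this
  have h1 : Tendsto f atTop (𝓝 1) := by
    have := (tendsto_concentration_one (σ := σ)).comp Real.tendsto_exp_atTop
    exact (ENNReal.tendsto_toReal ENNReal.one_ne_top).comp this
  have hYm : Measurable (fun φ : AffP => -Real.log φ.1.1) := by fun_prop
  have hsub : ∀ s, f s ≤ ∫ φ : AffP, f (s + -Real.log φ.1.1) ∂lam := by
    intro s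
    have e : ∀ φ : AffP, concentration σ (Real.exp s / φ.1.1) =
        ENNReal.ofReal (f (s + -Real.log φ.1.1)) := by
      intro φ
      rw [hf, ENNReal.ofReal_toReal (concentration_ne_top σ _), ← sub_eq_add_neg, Real.exp_sub,
        Real.exp_log φ.2]
    have hle := h.concentration_le (Real.exp s)
    simp_rw [e] at hle
    have hfm := hmono.measurable
    rw [integral_eq_lintegral_of_nonneg_ae (Eventually.of_forall fun φ => ENNReal.toReal_nonneg)
      (hfm.comp (by fun_prop : Measurable fun φ : AffP => s + -Real.log φ.1.1)).aestronglyMeasurable]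
    refine ENNReal.toReal_mono ?_ hle
    refine ((lintegral_mono (g := fun _ => 1) fun φ => ?_).trans_lt (by simp)).ne
    rw [← e]
    exact concentration_le_one σ _
  have hY0 := ae_eq_zero_of_monotone_subharmonic hmono h0 h1 hYm hintg.neg hsub
    (by simp only [integral_neg]; linarith)
  have hr : ∀ᵐ φ ∂lam, φ.1.1 = 1 := by
    filter_upwards [hY0] with φ hφ
    exact Real.eq_one_of_pos_of_log_eq_zero φ.2 (neg_eq_zero.1 hφ)
  refine hnofix ⟨0, forall_msupport_of_ae ?_⟩
  filter_upwards [h.ae_translation_eq_zero hr] with φ hφ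
  simp [hφ]

end Drift

section Moments

variable {lam : Measure AffP} {σ : Measure ℝ}

/-- If the dilation part has finite moments of orders `±ε` and negative logarithmic mean, then it
contracts in `L^γ` for every sufficiently small `γ`. -/
lemma exists_lintegral_rpow_lt_one [IsProbabilityMeasure lam] {ε : ℝ} (hε : 0 < ε)
    (hp : ∫⁻ φ : AffP, ENNReal.ofReal (φ.1.1 ^ ε) ∂lam < ⊤)
    (hn : ∫⁻ φ : AffP, ENNReal.ofReal (φ.1.1 ^ (-ε)) ∂lam < ⊤)
    (hlog : Integrable (fun φ : AffP => Real.log φ.1.1) lam →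
      ∫ φ : AffP, Real.log φ.1.1 ∂lam < 0) {c : ℝ} (hc : 0 < c) :
    ∃ γ, 0 < γ ∧ γ ≤ c ∧ ∫⁻ φ : AffP, ENNReal.ofReal (φ.1.1 ^ γ) ∂lam < 1 := by
  set X : AffP → ℝ := fun φ => Real.log φ.1.1 with hX
  have hexp : ∀ (t : ℝ) (φ : AffP), Real.exp (t * X φ) = φ.1.1 ^ t := fun t φ => by
    rw [Real.rpow_def_of_pos φ.2, mul_comm]
  have hmem : ∀ t : ℝ, ∫⁻ φ : AffP, ENNReal.ofReal (φ.1.1 ^ t) ∂lam < ⊤ →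
      t ∈ ProbabilityTheory.integrableExpSet X lam := by
    intro t ht
    have hm : Measurable fun φ : AffP => Real.exp (t * X φ) := by fun_prop
    refine ⟨hm.aestronglyMeasurable, ?_⟩
    rw [hasFiniteIntegral_iff_ofReal (Eventually.of_forall fun φ => (Real.exp_pos _).le)]
    simpa only [hexp] using ht
  have hintg : (0 : ℝ) ∈ interior (ProbabilityTheory.integrableExpSet X lam) := by
    refine mem_interior.2 ⟨Set.Ioo (-ε) ε, fun t ht => ?_, isOpen_Ioo, by simp [hε]⟩
    exact ProbabilityTheory.convex_integrableExpSet.ordConnected.out (hmem _ hn) (hmem _ hp)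
      ⟨ht.1.le, ht.2.le⟩
  have hd := ProbabilityTheory.hasDerivAt_mgf hintg
  have hneg := hlog (ProbabilityTheory.integrable_of_mem_interior_integrableExpSet hintg)
  simp only [zero_mul, Real.exp_zero, mul_one] at hd
  have hev : ∀ᶠ t in 𝓝[>] (0 : ℝ), ProbabilityTheory.mgf X lam t < 1 := by
    have hs := hasDerivAt_iff_tendsto_slope.1 hd
    have hs' := hs.mono_left (nhdsWithin_mono 0 fun x (hx : 0 < x) => hx.ne')
    filter_upwards [hs'.eventually_lt_const hneg, self_mem_nhdsWithin] with t ht ht0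
    rw [slope_def_field, ProbabilityTheory.mgf_zero, sub_zero,
      div_lt_iff₀ (show (0 : ℝ) < t from ht0), zero_mul] at ht
    linarith
  have hI : ∀ᶠ t in 𝓝[>] (0 : ℝ), t ∈ ProbabilityTheory.integrableExpSet X lam :=
    nhdsWithin_le_nhds (mem_interior_iff_mem_nhds.1 hintg)
  obtain ⟨γ, ⟨hγ1, hγI⟩, hγ0, hγc⟩ := ((hev.and hI).and (Ioc_mem_nhdsGT hc)).exists
  refine ⟨γ, hγ0, hγc, ?_⟩
  rw [ProbabilityTheory.mgf] at hγ1
  have := ofReal_integral_eq_lintegral_ofReal hγI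
    (Eventually.of_forall fun φ => (Real.exp_pos _).le)
  simp only [hexp] at this hγ1
  rw [← this, ENNReal.ofReal_lt_one]
  exact hγ1

/-- A nonnegative function satisfying a drift inequality is integrable for the stationary
measure. -/
lemma IsAffStationary.lintegral_le_of_drift [IsProbabilityMeasure lam] [IsProbabilityMeasure σ]
    (h : IsAffStationary lam σ) {f : ℝ → ℝ} (hf : Measurable f) (hf0 : ∀ x, 0 ≤ f x) {ρ B : ℝ}
    (hρ0 : 0 ≤ ρ) (hρ1 : ρ < 1) (hB : 0 ≤ B)
    (hdrift : ∀ x, ∫⁻ φ : AffP, ENNReal.ofReal (f (φ.1.1 * x + φ.1.2)) ∂lam ≤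
      ENNReal.ofReal (ρ * f x + B)) :
    ∫⁻ x, ENNReal.ofReal ((1 - ρ) * f x) ∂σ ≤ ENNReal.ofReal B := by
  have hρ : 0 < 1 - ρ := by linarith
  have key : ∀ M : ℝ, B / (1 - ρ) ≤ M →
      ∫⁻ x, ENNReal.ofReal ((1 - ρ) * if f x ≤ M then f x else 0) ∂σ ≤ ENNReal.ofReal B := by
    intro M hM
    rw [div_le_iff₀ hρ] at hM
    have hM0 : 0 ≤ M := by nlinarith
    have h1 : ∫⁻ x, ENNReal.ofReal (min (f x) M) ∂σ ≤
        ∫⁻ x, ENNReal.ofReal (min (ρ * f x + B) M) ∂σ := by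
      rw [h.lintegral_eq (by fun_prop)]
      refine lintegral_mono fun x => ?_
      rw [ENNReal.ofReal_min]
      refine le_min (le_trans (lintegral_mono fun φ => ?_) (hdrift x))
        (le_trans (lintegral_mono (g := fun _ => ENNReal.ofReal M) fun φ => ?_) (by simp))
      · exact ENNReal.ofReal_le_ofReal (min_le_left _ _)
      · exact ENNReal.ofReal_le_ofReal (min_le_right _ _)
    have h2 : ∀ x, ENNReal.ofReal (min (ρ * f x + B) M) +
        ENNReal.ofReal ((1 - ρ) * if f x ≤ M then f x else 0) ≤
        ENNReal.ofReal (min (f x) M) + ENNReal.ofReal B := by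
      intro x
      have hfx := hf0 x
      have hn1 : 0 ≤ min (ρ * f x + B) M := le_min (by positivity) hM0
      have hn2 : 0 ≤ min (f x) M := le_min hfx hM0
      have hn3 : 0 ≤ (1 - ρ) * if f x ≤ M then f x else 0 := by
        split_ifs
        · exact mul_nonneg hρ.le hfx
        · simp
      rw [← ENNReal.ofReal_add hn1 hn3, ← ENNReal.ofReal_add hn2 hB]
      refine ENNReal.ofReal_le_ofReal ?_
      split_ifs with hle
      · rw [min_eq_left hle]
        have := min_le_left (ρ * f x + B) M
        linarith
      · rw [min_eq_right (not_le.1 hle).le]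
        have := min_le_right (ρ * f x + B) M
        linarith
    have h3 := lintegral_mono (μ := σ) h2
    rw [lintegral_add_left (by fun_prop), lintegral_add_left (by fun_prop), lintegral_const,
      measure_univ, mul_one] at h3
    have h4 := h3.trans (add_le_add_left h1 _)
    refine (ENNReal.add_le_add_iff_left ?_).1 h4
    refine ((lintegral_mono (g := fun _ => ENNReal.ofReal M) fun x =>
      ENNReal.ofReal_le_ofReal (min_le_right _ _)).trans_lt ?_).ne
    simp
  have hmeas : ∀ n : ℕ, Measurable fun x =>
      ENNReal.ofReal ((1 - ρ) * if f x ≤ (n : ℝ) then f x else 0) := fun n =>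
    (measurable_const.mul
      (Measurable.ite (measurableSet_le hf measurable_const) hf measurable_const)).ennreal_ofReal
  have hlim : ∀ x, Tendsto (fun n : ℕ => ENNReal.ofReal ((1 - ρ) * if f x ≤ (n : ℝ) then f x else 0))
      atTop (𝓝 (ENNReal.ofReal ((1 - ρ) * f x))) := by
    intro x
    refine tendsto_const_nhds.congr' ?_
    filter_upwards [eventually_ge_atTop ⌈f x⌉₊] with n hn
    rw [if_pos (Nat.ceil_le.1 hn)]
  have hmono : ∀ x, Monotone fun n : ℕ =>
      ENNReal.ofReal ((1 - ρ) * if f x ≤ (n : ℝ) then f x else 0) := by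
    intro x m n hmn
    refine ENNReal.ofReal_le_ofReal (mul_le_mul_of_nonneg_left ?_ hρ.le)
    have : (m : ℝ) ≤ n := by exact_mod_cast hmn
    have := hf0 x
    split_ifs <;> linarith
  refine le_of_tendsto (lintegral_tendsto_of_tendsto_of_monotone (fun n => (hmeas n).aemeasurable)
    (Eventually.of_forall hmono) (Eventually.of_forall hlim)) ?_
  filter_upwards [eventually_ge_atTop ⌈B / (1 - ρ)⌉₊] with n hn
  exact key n (Nat.ceil_le.1 hn)

lemma IsAffStationary.lintegral_abs_rpow_lt_top [IsProbabilityMeasure lam]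
    [IsProbabilityMeasure σ] (h : IsAffStationary lam σ) {γ : ℝ} (hγ0 : 0 < γ) (hγ1 : γ ≤ 1)
    (hr : ∫⁻ φ : AffP, ENNReal.ofReal (φ.1.1 ^ γ) ∂lam < 1)
    (hb : ∫⁻ φ : AffP, ENNReal.ofReal (|φ.1.2| ^ γ) ∂lam < ⊤) :
    ∫⁻ s, ENNReal.ofReal (|s| ^ γ) ∂σ < ⊤ := by
  set ρ := ∫⁻ φ : AffP, ENNReal.ofReal (φ.1.1 ^ γ) ∂lam with hρ
  set B := ∫⁻ φ : AffP, ENNReal.ofReal (|φ.1.2| ^ γ) ∂lam with hB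
  have hρtop : ρ ≠ ⊤ := (hr.trans ENNReal.one_lt_top).ne
  have hρ1 : ρ.toReal < 1 := by simpa using (ENNReal.toReal_lt_toReal hρtop ENNReal.one_ne_top).2 hr
  have hmain := h.lintegral_le_of_drift (f := fun x => |x| ^ γ) (by fun_prop)
    (fun x => by positivity) ENNReal.toReal_nonneg hρ1 (B := B.toReal) ENNReal.toReal_nonneg ?_
  · simp_rw [ENNReal.ofReal_mul (sub_nonneg.2 hρ1.le)] at hmain
    rw [lintegral_const_mul _ (by fun_prop)] at hmain
    refine lt_of_le_of_ne le_top fun htop => ?_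
    rw [htop, ENNReal.mul_top (by simpa using hρ1)] at hmain
    exact ENNReal.ofReal_ne_top (top_le_iff.1 hmain)
  · intro x
    rw [ENNReal.ofReal_add (by positivity) ENNReal.toReal_nonneg, ENNReal.ofReal_mul (by positivity),
      ENNReal.ofReal_toReal hρtop, ENNReal.ofReal_toReal hb.ne, hρ, hB,
      ← lintegral_mul_const _ (by fun_prop), ← lintegral_add_left (by fun_prop)]
    refine lintegral_mono fun φ => ?_
    have hrφ := φ.2
    rw [← ENNReal.ofReal_mul (by positivity), ← ENNReal.ofReal_add (by positivity) (by positivity)]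
    refine ENNReal.ofReal_le_ofReal ?_
    calc |φ.1.1 * x + φ.1.2| ^ γ ≤ (|φ.1.1 * x| + |φ.1.2|) ^ γ := by
          gcongr
          exact abs_add_le _ _
      _ ≤ |φ.1.1 * x| ^ γ + |φ.1.2| ^ γ :=
          Real.rpow_add_le_add_rpow (abs_nonneg _) (abs_nonneg _) hγ0.le hγ1
      _ = φ.1.1 ^ γ * |x| ^ γ + |φ.1.2| ^ γ := by
          rw [abs_mul, abs_of_pos hrφ, Real.mul_rpow hrφ.le (abs_nonneg _)]

end Moments

section Hoelder

variable {lam : Measure AffP} {σ : Measure ℝ}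

/-- The transition operator of the random walk on `ℝ` driven by the inverse maps. -/
noncomputable def backwardOp (lam : Measure AffP) (g : ℝ → ENNReal) (y : ℝ) : ENNReal :=
  ∫⁻ φ : AffP, g ((y - φ.1.2) / φ.1.1) ∂lam

lemma measurable_backwardOp [SFinite lam] {g : ℝ → ENNReal} (hg : Measurable g) :
    Measurable (backwardOp lam g) :=
  Measurable.lintegral_prod_right' (f := fun p : ℝ × AffP => g ((p.1 - p.2.1.2) / p.2.1.1))
    (hg.comp (by fun_prop))

lemma measurable_iterate_backwardOp [SFinite lam] {g : ℝ → ENNReal} (hg : Measurable g) (n : ℕ) :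
    Measurable ((backwardOp lam)^[n] g) := by
  induction n with
  | zero => exact hg
  | succ n ih =>
    rw [Function.iterate_succ_apply']
    exact measurable_backwardOp ih

lemma backwardOp_mono : Monotone (backwardOp lam) := fun _ _ hgh _ => lintegral_mono fun _ => hgh _

lemma backwardOp_const_mul (a : ENNReal) (ha : a ≠ ⊤) (g : ℝ → ENNReal) :
    backwardOp lam (fun y => a * g y) = fun y => a * backwardOp lam g y :=
  funext fun _ => lintegral_const_mul' _ _ ha

lemma iterate_backwardOp_const_mul (a : ENNReal) (ha : a ≠ ⊤) (g : ℝ → ENNReal) (n : ℕ) :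
    (backwardOp lam)^[n] (fun y => a * g y) = fun y => a * (backwardOp lam)^[n] g y := by
  induction n with
  | zero => rfl
  | succ n ih => rw [Function.iterate_succ_apply', Function.iterate_succ_apply', ih,
      backwardOp_const_mul a ha]

lemma lintegral_ofReal_div_rpow [IsProbabilityMeasure lam] {t : ℝ} (ht : 0 < t) (p : ℝ) :
    ∫⁻ φ : AffP, ENNReal.ofReal ((t / φ.1.1) ^ p) ∂lam =
      ENNReal.ofReal (t ^ p) * ∫⁻ φ : AffP, ENNReal.ofReal (φ.1.1 ^ (-p)) ∂lam := by
  rw [← lintegral_const_mul _ (by fun_prop)]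
  refine lintegral_congr fun φ => ?_
  have hr := φ.2
  rw [← ENNReal.ofReal_mul (by positivity), Real.div_rpow ht.le hr.le, Real.rpow_neg hr.le,
    div_eq_mul_inv]

lemma measurable_measure_Icc_inv (σ : Measure ℝ) [SFinite σ] (y t : ℝ) :
    Measurable fun φ : AffP => σ (Set.Icc ((y - φ.1.2) / φ.1.1 - t / φ.1.1)
        ((y - φ.1.2) / φ.1.1 + t / φ.1.1)) :=
  (measurable_measure_Icc σ).comp
    (by fun_prop : Measurable fun φ : AffP => ((y - φ.1.2) / φ.1.1, t / φ.1.1))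

lemma IsAffStationary.iterate_backwardOp_le [IsProbabilityMeasure lam] [IsProbabilityMeasure σ]
    (h : IsAffStationary lam σ) {γ : ℝ} {g : ℝ → ENNReal} {K c : ENNReal}
    (hg : ∀ y t, 0 < t → g y ≤
      K + 2 * σ (Set.Icc (y - t) (y + t)) + c * ENNReal.ofReal (t ^ (-γ))) (n : ℕ) :
    ∀ y t, 0 < t → (backwardOp lam)^[n] g y ≤ K + 2 * σ (Set.Icc (y - t) (y + t)) +
      c * (∫⁻ φ : AffP, ENNReal.ofReal (φ.1.1 ^ γ) ∂lam) ^ n * ENNReal.ofReal (t ^ (-γ)) := by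
  set ρ := ∫⁻ φ : AffP, ENNReal.ofReal (φ.1.1 ^ γ) ∂lam with hρ
  induction n with
  | zero => simpa using hg
  | succ n ih =>
    intro y t ht
    rw [Function.iterate_succ_apply']
    have hmeas := measurable_measure_Icc_inv σ y t
    have hmeas' : Measurable fun φ : AffP => K + 2 * σ (Set.Icc
        ((y - φ.1.2) / φ.1.1 - t / φ.1.1) ((y - φ.1.2) / φ.1.1 + t / φ.1.1)) :=
      measurable_const.add (hmeas.const_mul 2)
    calc backwardOp lam ((backwardOp lam)^[n] g) y
        ≤ ∫⁻ φ : AffP, (K + 2 * σ (Set.Icc ((y - φ.1.2) / φ.1.1 - t / φ.1.1)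
            ((y - φ.1.2) / φ.1.1 + t / φ.1.1)) +
            c * ρ ^ n * ENNReal.ofReal ((t / φ.1.1) ^ (-γ))) ∂lam :=
          lintegral_mono fun φ => ih _ _ (div_pos ht φ.2)
      _ = K + 2 * σ (Set.Icc (y - t) (y + t)) + c * ρ ^ (n + 1) * ENNReal.ofReal (t ^ (-γ)) := by
          rw [lintegral_add_left hmeas',
            lintegral_add_left measurable_const,
            lintegral_const_mul _ hmeas, lintegral_const_mul _ (by fun_prop),
            ← h.measure_Icc, lintegral_ofReal_div_rpow ht, neg_neg, ← hρ]
          simp only [lintegral_const, measure_univ, mul_one]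
          ring

lemma IsAffStationary.measure_Icc_le_iterate [IsProbabilityMeasure lam] [IsProbabilityMeasure σ]
    (h : IsAffStationary lam σ) {γ : ℝ} {g : ℝ → ENNReal} (hgm : Measurable g) {C B : ENNReal}
    (hC : C ≠ ⊤)
    (hB : ∫⁻ φ : AffP, ENNReal.ofReal (φ.1.1 ^ (-γ)) ∂lam ≤ B)
    (hg : ∀ y t, 0 < t → σ (Set.Icc (y - t) (y + t)) ≤ C * (g y + ENNReal.ofReal (t ^ γ)))
    (n : ℕ) :
    ∀ y t, 0 < t → σ (Set.Icc (y - t) (y + t)) ≤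
      C * ((backwardOp lam)^[n] g y + B ^ n * ENNReal.ofReal (t ^ γ)) := by
  induction n with
  | zero => simpa using hg
  | succ n ih =>
    intro y t ht
    rw [Function.iterate_succ_apply', h.measure_Icc]
    have hm' : Measurable fun φ : AffP => (backwardOp lam)^[n] g ((y - φ.1.2) / φ.1.1) :=
      (measurable_iterate_backwardOp hgm n).comp (by fun_prop)
    calc ∫⁻ φ : AffP, σ (Set.Icc ((y - φ.1.2) / φ.1.1 - t / φ.1.1)
            ((y - φ.1.2) / φ.1.1 + t / φ.1.1)) ∂lam
        ≤ ∫⁻ φ : AffP, C * ((backwardOp lam)^[n] g ((y - φ.1.2) / φ.1.1) +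
            B ^ n * ENNReal.ofReal ((t / φ.1.1) ^ γ)) ∂lam :=
          lintegral_mono fun φ => ih _ _ (div_pos ht φ.2)
      _ = C * (backwardOp lam ((backwardOp lam)^[n] g) y + B ^ n * (ENNReal.ofReal (t ^ γ) *
            ∫⁻ φ : AffP, ENNReal.ofReal (φ.1.1 ^ (-γ)) ∂lam)) := by
          rw [lintegral_const_mul' _ _ hC, lintegral_add_left hm',
            lintegral_const_mul _ (by fun_prop), lintegral_ofReal_div_rpow ht]
          rfl
      _ ≤ C * (backwardOp lam ((backwardOp lam)^[n] g) y + B ^ n * (ENNReal.ofReal (t ^ γ) * B)) := by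
          gcongr
      _ = _ := by ring

/-- The weight `(1 + |y|) ^ (-γ)`. -/
noncomputable def decayWeight (γ y : ℝ) : ENNReal := ENNReal.ofReal ((1 + |y|) ^ (-γ))

lemma measurable_decayWeight (γ : ℝ) : Measurable (decayWeight γ) := by
  unfold decayWeight
  fun_prop

lemma decayWeight_le_one {γ : ℝ} (hγ : 0 ≤ γ) (y : ℝ) : decayWeight γ y ≤ 1 := by
  rw [decayWeight, ENNReal.ofReal_le_one]
  exact Real.rpow_le_one_of_one_le_of_nonpos (by linarith [abs_nonneg y]) (by linarith)

lemma decayWeight_inv_le {γ : ℝ} (hγ0 : 0 < γ) (hγ1 : γ ≤ 1) (φ : AffP) (y : ℝ) :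
    decayWeight γ ((y - φ.1.2) / φ.1.1) ≤ (ENNReal.ofReal (φ.1.1 ^ γ) +
      decayWeight γ y * ENNReal.ofReal ((1 + φ.1.1 + |φ.1.2|) ^ (2 * γ))) * decayWeight γ y := by
  have hr := φ.2
  set r := φ.1.1
  set b := φ.1.2
  set z := (y - b) / r with hz
  have hy : y = r * z + b := by rw [hz]; field_simp; ring
  unfold decayWeight
  rw [← ENNReal.ofReal_mul (by positivity), ← ENNReal.ofReal_add (by positivity) (by positivity),
    ← ENNReal.ofReal_mul (by positivity)]
  refine ENNReal.ofReal_le_ofReal ?_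
  have hyabs : |y| ≤ r * |z| + |b| := by
    rw [hy]
    refine (abs_add_le _ _).trans ?_
    rw [abs_mul, abs_of_pos hr]
  have hz0 := abs_nonneg z
  have hb0 := abs_nonneg b
  have h1 : (1 + |y|) ^ γ ≤ r ^ γ * (1 + |z|) ^ γ + (1 + r + |b|) ^ γ := by
    calc (1 + |y|) ^ γ ≤ (r * (1 + |z|) + (1 + r + |b|)) ^ γ :=
          Real.rpow_le_rpow (by positivity) (by nlinarith) hγ0.le
      _ ≤ (r * (1 + |z|)) ^ γ + (1 + r + |b|) ^ γ :=
          Real.rpow_add_le_add_rpow (by positivity) (by positivity) hγ0.le hγ1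
      _ = _ := by rw [Real.mul_rpow hr.le (by positivity)]
  have h2 : (1 + |y|) ^ γ ≤ (1 + r + |b|) ^ γ * (1 + |z|) ^ γ := by
    rw [← Real.mul_rpow (by positivity) (by positivity)]
    exact Real.rpow_le_rpow (by positivity) (by nlinarith [mul_nonneg hb0 hz0]) hγ0.le
  rw [Real.rpow_neg (by positivity), Real.rpow_neg (by positivity), mul_comm 2 γ,
    Real.rpow_mul (by positivity), Real.rpow_two]
  have hA : 0 < (1 + |y|) ^ γ := by positivity
  have hC : 0 < (1 + |z|) ^ γ := by positivity
  have hR : 0 < r ^ γ := by positivity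
  have hW : 0 < (1 + r + |b|) ^ γ := by positivity
  generalize (1 + |y|) ^ γ = A at *
  generalize (1 + |z|) ^ γ = C at *
  generalize r ^ γ = R at *
  generalize (1 + r + |b|) ^ γ = W at *
  have e : (R + A⁻¹ * W ^ 2) * A⁻¹ = (R * A + W ^ 2) / A ^ 2 := by field_simp
  rw [e, inv_eq_one_div, div_le_div_iff₀ hC (by positivity)]
  nlinarith [mul_le_mul_of_nonneg_left h1 hA.le, mul_le_mul_of_nonneg_left h2 hW.le]

lemma backwardOp_decayWeight_le [IsProbabilityMeasure lam] {γ : ℝ} (hγ0 : 0 < γ) (hγ1 : γ ≤ 1)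
    (y : ℝ) :
    backwardOp lam (decayWeight γ) y ≤ (∫⁻ φ : AffP, ENNReal.ofReal (φ.1.1 ^ γ) ∂lam +
      decayWeight γ y * ∫⁻ φ : AffP, ENNReal.ofReal ((1 + φ.1.1 + |φ.1.2|) ^ (2 * γ)) ∂lam) *
        decayWeight γ y := by
  rw [← lintegral_const_mul _ (by fun_prop), ← lintegral_add_left (by fun_prop),
    ← lintegral_mul_const _ (by fun_prop)]
  exact lintegral_mono fun φ => decayWeight_inv_le hγ0 hγ1 φ y

lemma measure_Icc_le_decayWeight [IsProbabilityMeasure σ] {γ : ℝ} (hγ0 : 0 < γ) (y t : ℝ) :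
    σ (Set.Icc (y - t) (y + t)) ≤ (1 + ∫⁻ s, ENNReal.ofReal ((2 * (1 + |s|)) ^ γ) ∂σ) *
      (decayWeight γ y + ENNReal.ofReal (t ^ γ)) := by
  rcases le_total 1 t with h1 | h1
  · calc σ (Set.Icc (y - t) (y + t)) ≤ 1 * 1 := by simpa using prob_le_one
      _ ≤ _ := by
        gcongr
        · exact le_self_add
        · refine le_trans ?_ le_add_self
          rw [ENNReal.one_le_ofReal]
          exact Real.one_le_rpow h1 hγ0.le
  · have key : σ (Set.Icc (y - t) (y + t)) ≤
        ∫⁻ s, ENNReal.ofReal ((2 * (1 + |s|)) ^ γ) * decayWeight γ y ∂σ := by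
      rw [← lintegral_indicator_one measurableSet_Icc]
      refine lintegral_mono fun s => ?_
      by_cases hs : s ∈ Set.Icc (y - t) (y + t)
      · rw [Set.indicator_of_mem hs, Pi.one_apply, decayWeight,
          ← ENNReal.ofReal_mul (by positivity), ENNReal.one_le_ofReal,
          Real.rpow_neg (by positivity), ← div_eq_mul_inv, one_le_div (by positivity)]
        refine Real.rpow_le_rpow (by positivity) ?_ hγ0.le
        have : |y| ≤ |s| + 1 := by
          have h3 := abs_sub_abs_le_abs_sub y s
          have h4 : |y - s| ≤ t := abs_sub_le_iff.2 ⟨by linarith [hs.1], by linarith [hs.2]⟩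
          linarith
        linarith [abs_nonneg s]
      · rw [Set.indicator_of_notMem hs]
        exact bot_le
    rw [lintegral_mul_const _ (by fun_prop)] at key
    refine key.trans ?_
    gcongr
    · exact le_add_self
    · exact le_self_add

lemma decayWeight_le_measure_Icc {γ : ℝ} (hγ0 : 0 < γ) {M : ℝ} (hM0 : 0 < M)
    (hM : 1 / 2 ≤ σ (Set.Icc (-M) M)) (y t : ℝ) (ht : 0 < t) :
    decayWeight γ y ≤ ENNReal.ofReal ((1 + M) ^ (-γ)) + 2 * σ (Set.Icc (y - t) (y + t)) +
      ENNReal.ofReal ((2 * M) ^ γ) * ENNReal.ofReal (t ^ (-γ)) := by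
  rcases le_total M |y| with hy | hy
  · refine le_trans (ENNReal.ofReal_le_ofReal ?_) (le_self_add.trans le_self_add)
    exact Real.rpow_le_rpow_of_nonpos (by positivity) (by linarith) (by linarith)
  refine (decayWeight_le_one hγ0.le y).trans ?_
  rcases le_total (2 * M) t with h2 | h2
  · refine le_trans ?_ (le_add_self.trans le_self_add)
    have hsub : Set.Icc (-M) M ⊆ Set.Icc (y - t) (y + t) :=
      Set.Icc_subset_Icc (by linarith [le_abs_self y]) (by linarith [neg_abs_le y])
    calc (1 : ENNReal) = 2 * (1 / 2) := by
          rw [one_div, ENNReal.mul_inv_cancel two_ne_zero ENNReal.ofNat_ne_top]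
      _ ≤ _ := by gcongr; exact hM.trans (measure_mono hsub)
  · refine le_trans ?_ le_add_self
    rw [← ENNReal.ofReal_mul (by positivity), ENNReal.one_le_ofReal, Real.rpow_neg ht.le,
      ← div_eq_mul_inv, one_le_div (by positivity)]
    exact Real.rpow_le_rpow ht.le h2 hγ0.le

lemma IsAffStationary.exists_iterate_decayWeight_le [IsProbabilityMeasure lam]
    [IsProbabilityMeasure σ] (h : IsAffStationary lam σ) (hσ : ∀ x, σ {x} = 0) {γ : ℝ}
    (hγ0 : 0 < γ) (hr : ∫⁻ φ : AffP, ENNReal.ofReal (φ.1.1 ^ γ) ∂lam < 1) {δ : ENNReal}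
    (hδ : 0 < δ) : ∃ n₀, ∀ n ≥ n₀, ∀ y, (backwardOp lam)^[n] (decayWeight γ) y ≤ δ := by
  have hδ3 : 0 < δ / 3 := ENNReal.div_pos hδ.ne' ENNReal.ofNat_ne_top
  have hlimM : Tendsto (fun M : ℝ => ENNReal.ofReal ((1 + M) ^ (-γ))) atTop (𝓝 0) := by
    have := ((tendsto_rpow_neg_atTop hγ0).comp (tendsto_atTop_add_const_left _ 1 tendsto_id))
    have h0 := (ENNReal.continuous_ofReal.tendsto 0).comp this
    rw [ENNReal.ofReal_zero] at h0
    exact h0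
  obtain ⟨M, ⟨hM1, hM2⟩, hM0⟩ := (((hlimM.eventually_le_const hδ3).and
    ((tendsto_measure_Icc_neg_self (σ := σ)).eventually_const_le
      (show (1 / 2 : ENNReal) < 1 from ENNReal.half_lt_self one_ne_zero ENNReal.one_ne_top))).and
    (eventually_gt_atTop 0)).exists
  obtain ⟨t, ht0, ht⟩ := exists_radius_measure_Icc_le hσ
    (ENNReal.div_pos hδ3.ne' (ENNReal.ofNat_ne_top (n := 2)))
  have hlimn : Tendsto (fun n : ℕ => ENNReal.ofReal ((2 * M) ^ γ) *
      (∫⁻ φ : AffP, ENNReal.ofReal (φ.1.1 ^ γ) ∂lam) ^ n * ENNReal.ofReal (t ^ (-γ)))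
      atTop (𝓝 0) := by
    have h1 := ENNReal.tendsto_pow_atTop_nhds_zero_of_lt_one hr
    have h2 := ENNReal.Tendsto.mul_const (b := ENNReal.ofReal (t ^ (-γ)))
      (ENNReal.Tendsto.const_mul (a := ENNReal.ofReal ((2 * M) ^ γ)) h1
      (Or.inr ENNReal.ofReal_ne_top)) (Or.inr ENNReal.ofReal_ne_top)
    simpa using h2
  obtain ⟨n₀, hn₀⟩ := eventually_atTop.1 (hlimn.eventually_le_const hδ3)
  refine ⟨n₀, fun n hn y => ?_⟩
  refine (h.iterate_backwardOp_le (decayWeight_le_measure_Icc hγ0 hM0 hM2) n y t ht0).trans ?_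
  calc _ ≤ δ / 3 + 2 * (δ / 3 / 2) + δ / 3 := by
        gcongr
        · exact ht y
        · exact hn₀ n hn
    _ = δ := by
        rw [ENNReal.mul_div_cancel two_ne_zero ENNReal.ofNat_ne_top, ENNReal.add_thirds]

lemma IsAffStationary.exists_iterate_decayWeight_le_half [IsProbabilityMeasure lam]
    [IsProbabilityMeasure σ] (h : IsAffStationary lam σ) (hσ : ∀ x, σ {x} = 0) {γ : ℝ}
    (hγ0 : 0 < γ) (hγ1 : γ ≤ 1)
    (hr : ∫⁻ φ : AffP, ENNReal.ofReal (φ.1.1 ^ γ) ∂lam < 1)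
    (hD : ∫⁻ φ : AffP, ENNReal.ofReal ((1 + φ.1.1 + |φ.1.2|) ^ (2 * γ)) ∂lam < ⊤) :
    ∃ N, ∀ y, (backwardOp lam)^[N] (decayWeight γ) y ≤ 1 / 2 * decayWeight γ y := by
  have hPV := backwardOp_decayWeight_le (lam := lam) hγ0 hγ1
  set ρ := ∫⁻ φ : AffP, ENNReal.ofReal (φ.1.1 ^ γ) ∂lam with hρ
  set D := ∫⁻ φ : AffP, ENNReal.ofReal ((1 + φ.1.1 + |φ.1.2|) ^ (2 * γ)) ∂lam with hDdef
  obtain ⟨ρ', hρρ', hρlt'⟩ := exists_between hr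
  have hρ'top : ρ' ≠ ⊤ := (hρlt'.trans ENNReal.one_lt_top).ne
  set δ := (ρ' - ρ) / D with hδdef
  have hδ : 0 < δ := ENNReal.div_pos (tsub_pos_of_lt hρρ').ne' hD.ne
  have hfar : ∀ y, decayWeight γ y ≤ δ →
      backwardOp lam (decayWeight γ) y ≤ ρ' * decayWeight γ y := by
    intro y hy
    refine (hPV y).trans (mul_le_mul_left ?_ _)
    calc ρ + decayWeight γ y * D ≤ ρ + D * δ := by rw [mul_comm]; gcongr
      _ ≤ ρ + (ρ' - ρ) := by gcongr; exact ENNReal.mul_div_le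
      _ = ρ' := add_tsub_cancel_of_le hρρ'.le
  set L := ρ + D with hL
  have hLtop : L ≠ ⊤ := ENNReal.add_ne_top.2 ⟨(hρρ'.trans_le le_top).ne, hD.ne⟩
  have hglob : ∀ y, backwardOp lam (decayWeight γ) y ≤ L * decayWeight γ y := by
    intro y
    refine (hPV y).trans (mul_le_mul_left ?_ _)
    rw [hL]
    gcongr
    exact mul_le_of_le_one_left' (decayWeight_le_one hγ0.le y)
  have hL_iter : ∀ n y, (backwardOp lam)^[n] (decayWeight γ) y ≤ L ^ n * decayWeight γ y := by
    intro n
    induction n with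
    | zero => simp
    | succ n ih =>
      intro y
      rw [Function.iterate_succ_apply']
      refine (backwardOp_mono (b := fun y => L ^ n * decayWeight γ y) ih y).trans ?_
      rw [backwardOp_const_mul _ (ENNReal.pow_ne_top hLtop), pow_succ, mul_assoc]
      exact mul_le_mul_right (hglob y) _
  obtain ⟨n₀, hn₀⟩ := h.exists_iterate_decayWeight_le hσ hγ0 hr
    (ENNReal.div_pos hδ.ne' (ENNReal.ofNat_ne_top (n := 2)))
  have hk : ∀ k y, (backwardOp lam)^[n₀ + k] (decayWeight γ) y ≤
      max (ρ' ^ k * L ^ n₀) (1 / 2) * decayWeight γ y := by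
    intro k
    induction k with
    | zero =>
      intro y
      refine (hL_iter n₀ y).trans (mul_le_mul_left ?_ _)
      simp
    | succ k ih =>
      intro y
      rcases le_total (decayWeight γ y) δ with hy | hy
      · rw [← add_assoc, Function.iterate_succ_apply']
        refine (backwardOp_mono (b := fun y => max (ρ' ^ k * L ^ n₀) (1 / 2) * decayWeight γ y)
          ih y).trans ?_
        rw [backwardOp_const_mul _ (max_lt (ENNReal.mul_lt_top
          (ENNReal.pow_lt_top hρ'top.lt_top) (ENNReal.pow_lt_top hLtop.lt_top)) (by simp)).ne]
        calc max (ρ' ^ k * L ^ n₀) (1 / 2) * backwardOp lam (decayWeight γ) y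
            ≤ max (ρ' ^ k * L ^ n₀) (1 / 2) * (ρ' * decayWeight γ y) := by
              gcongr
              exact hfar y hy
          _ = max (ρ' ^ (k + 1) * L ^ n₀) (1 / 2 * ρ') * decayWeight γ y := by
              rw [← mul_assoc, max_mul]
              ring_nf
          _ ≤ _ := by
              gcongr
              exact mul_le_of_le_one_right' hρlt'.le
      · refine (hn₀ (n₀ + (k + 1)) le_self_add y).trans ?_
        rw [div_eq_mul_inv, mul_comm, ← one_div]
        gcongr
        exact le_max_right _ _
  have hlim : Tendsto (fun k : ℕ => ρ' ^ k * L ^ n₀) atTop (𝓝 0) := by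
    simpa using ENNReal.Tendsto.mul_const (b := L ^ n₀)
      (ENNReal.tendsto_pow_atTop_nhds_zero_of_lt_one hρlt') (Or.inr (ENNReal.pow_ne_top hLtop))
  obtain ⟨k, hk'⟩ := (hlim.eventually_le_const (show (0 : ENNReal) < 1 / 2 by simp)).exists
  refine ⟨n₀ + k, fun y => (hk k y).trans ?_⟩
  rw [max_eq_right hk']

lemma iterate_mul_backwardOp_le {g : ℝ → ENNReal} {a : ENNReal} (ha : a ≠ ⊤) {N : ℕ}
    (hN : ∀ y, (backwardOp lam)^[N] g y ≤ a * g y) (k : ℕ) :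
    ∀ y, (backwardOp lam)^[N * k] g y ≤ a ^ k * g y := by
  induction k with
  | zero => simp
  | succ k ih =>
    intro y
    rw [Nat.mul_succ, add_comm, Function.iterate_add_apply]
    refine (backwardOp_mono.iterate N (b := fun y => a ^ k * g y) ih y).trans ?_
    rw [iterate_backwardOp_const_mul _ (ENNReal.pow_ne_top ha), pow_succ, mul_assoc]
    exact mul_le_mul_right (hN y) _

lemma exists_half_pow_add_pow_mul_le {β γ : ℝ} (hβ : 1 ≤ β) (hγ : 0 < γ) :
    ∃ γ', 0 < γ' ∧ γ' ≤ γ ∧ ∀ t : ℝ, 0 < t → t < 1 →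
      ∃ k : ℕ, (1 / 2 : ℝ) ^ k + β ^ k * t ^ γ ≤ 3 * t ^ γ' := by
  have hlb := Real.log_nonneg hβ
  have hl2 : 0 < Real.log 2 := Real.log_pos one_lt_two
  set d := γ / (2 * (Real.log β + 1)) with hd
  have hd0 : 0 < d := by positivity
  have hdβ : d * Real.log β ≤ γ / 2 := by
    rw [hd, div_mul_eq_mul_div, div_le_div_iff₀ (by positivity) two_pos]
    nlinarith
  refine ⟨min (d * Real.log 2) (γ / 2), by positivity,
    (min_le_right _ _).trans (by linarith), fun t ht0 ht1 => ⟨⌊d * (-Real.log t)⌋₊, ?_⟩⟩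
  have hlt : Real.log t < 0 := Real.log_neg ht0 ht1
  set k := ⌊d * (-Real.log t)⌋₊ with hk
  have hk1 : (k : ℝ) ≤ d * (-Real.log t) := Nat.floor_le (by nlinarith)
  have hk2 : d * (-Real.log t) < k + 1 := Nat.lt_floor_add_one _
  have e1 : (1 / 2 : ℝ) ^ k ≤ 2 * t ^ min (d * Real.log 2) (γ / 2) := by
    calc (1 / 2 : ℝ) ^ k = Real.exp (-(k * Real.log 2)) := by
          rw [Real.exp_neg, mul_comm, Real.exp_mul, Real.exp_log two_pos, Real.rpow_natCast,
            one_div, inv_pow]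
      _ ≤ Real.exp (Real.log 2 + Real.log t * (d * Real.log 2)) :=
          Real.exp_le_exp.2 (by nlinarith)
      _ = 2 * t ^ (d * Real.log 2) := by
          rw [Real.exp_add, Real.exp_log two_pos, Real.rpow_def_of_pos ht0]
      _ ≤ _ := by
          gcongr 2 * ?_
          exact Real.rpow_le_rpow_of_exponent_ge ht0 ht1.le (min_le_left _ _)
  have e2 : β ^ k * t ^ γ ≤ t ^ min (d * Real.log 2) (γ / 2) := by
    calc β ^ k * t ^ γ = Real.exp (k * Real.log β + Real.log t * γ) := by
          rw [Real.exp_add, mul_comm (k : ℝ), Real.exp_mul, Real.exp_log (by linarith),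
            Real.rpow_natCast, Real.rpow_def_of_pos ht0]
      _ ≤ Real.exp (Real.log t * (γ / 2)) := by
          refine Real.exp_le_exp.2 ?_
          nlinarith [mul_le_mul_of_nonneg_right hk1 hlb,
            mul_le_mul_of_nonneg_right hdβ (neg_nonneg.2 hlt.le)]
      _ = t ^ (γ / 2) := by rw [Real.rpow_def_of_pos ht0]
      _ ≤ _ := Real.rpow_le_rpow_of_exponent_ge ht0 ht1.le (min_le_right _ _)
  linarith

lemma exists_measure_Icc_le_rpow [IsProbabilityMeasure σ] {γ : ℝ} (hγ : 0 < γ) {C β : ENNReal}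
    (hC : C ≠ ⊤) (hβ : β ≠ ⊤)
    (h : ∀ (k : ℕ) (y t : ℝ), 0 < t → σ (Set.Icc (y - t) (y + t)) ≤
      C * ((1 / 2) ^ k + β ^ k * ENNReal.ofReal (t ^ γ))) :
    ∃ γ', 0 < γ' ∧ γ' ≤ γ ∧ ∃ C' : ℝ, 0 < C' ∧
      ∀ r : ℝ, 0 < r → ∀ s : ℝ, σ (Set.Icc (s - r) (s + r)) ≤ ENNReal.ofReal (C' * r ^ γ') := by
  set b := max 1 β.toReal with hb
  have hβb : β ≤ ENNReal.ofReal b := by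
    rw [← ENNReal.ofReal_toReal hβ]
    exact ENNReal.ofReal_le_ofReal (le_max_right _ _)
  have hb0 : 0 ≤ b := zero_le_one.trans (le_max_left _ _)
  obtain ⟨γ', hγpos', hγ'γ, hγ'⟩ := exists_half_pow_add_pow_mul_le (le_max_left 1 β.toReal) hγ
  refine ⟨γ', hγpos', hγ'γ, 1 + 3 * C.toReal, by positivity, fun r hr s => ?_⟩
  rcases lt_or_ge r 1 with hr1 | hr1
  · obtain ⟨k, hk⟩ := hγ' r hr hr1
    calc σ (Set.Icc (s - r) (s + r)) ≤ C * ((1 / 2) ^ k + β ^ k * ENNReal.ofReal (r ^ γ)) :=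
          h k s r hr
      _ ≤ C * (ENNReal.ofReal ((1 / 2) ^ k) + ENNReal.ofReal (b ^ k * r ^ γ)) := by
          rw [ENNReal.ofReal_mul (by positivity), ENNReal.ofReal_pow (by positivity),
            ENNReal.ofReal_pow hb0]
          gcongr
          rw [one_div, one_div, ENNReal.ofReal_inv_of_pos two_pos]
          simp
      _ ≤ ENNReal.ofReal C.toReal * ENNReal.ofReal (3 * r ^ γ') := by
          rw [ENNReal.ofReal_toReal hC, ← ENNReal.ofReal_add (by positivity) (by positivity)]
          gcongr
      _ ≤ _ := by
          rw [← ENNReal.ofReal_mul ENNReal.toReal_nonneg]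
          refine ENNReal.ofReal_le_ofReal ?_
          have : 0 ≤ r ^ γ' := by positivity
          nlinarith
  · refine prob_le_one.trans (ENNReal.one_le_ofReal.2 ?_)
    have h1 := Real.one_le_rpow hr1 hγpos'.le
    have h2 := C.toReal_nonneg
    nlinarith

end Hoelder

section Comparison

lemma rpow_le_one_add_rpow {x p q : ℝ} (hx : 0 ≤ x) (hp : 0 ≤ p) (hpq : p ≤ q) :
    x ^ p ≤ 1 + x ^ q := by
  rcases le_total x 1 with h | h
  · linarith [Real.rpow_le_one hx h hp, Real.rpow_nonneg hx q]
  · linarith [Real.rpow_le_rpow_of_exponent_le h hpq]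

lemma one_add_add_rpow_le {x y p : ℝ} (hx : 0 ≤ x) (hy : 0 ≤ y) (hp : 0 ≤ p) :
    (1 + x + y) ^ p ≤ 3 ^ p * (1 + x ^ p + y ^ p) := by
  have hm : 1 + x + y ≤ 3 * max (max 1 x) y := by
    have h1 := le_max_left (max 1 x) y
    have h2 := le_max_right (max 1 x) y
    have h3 := le_max_left 1 x
    have h4 := le_max_right 1 x
    linarith
  have hx' := Real.rpow_nonneg hx p
  have hy' := Real.rpow_nonneg hy p
  have hm' : max (max 1 x) y ^ p ≤ 1 + x ^ p + y ^ p := by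
    rcases max_choice (max 1 x) y with h | h <;> rw [h]
    · rcases max_choice 1 x with h | h <;> rw [h]
      · rw [Real.one_rpow]
        linarith
      · linarith
    · linarith
  calc (1 + x + y) ^ p ≤ (3 * max (max 1 x) y) ^ p := by gcongr
    _ = 3 ^ p * max (max 1 x) y ^ p := Real.mul_rpow (by norm_num) (le_max_of_le_right hy)
    _ ≤ _ := by gcongr

lemma lintegral_ofReal_lt_top_of_le {α : Type*} [MeasurableSpace α] {μ : Measure α}
    [IsFiniteMeasure μ] {f g : α → ℝ} (hf : ∫⁻ x, ENNReal.ofReal (f x) ∂μ < ⊤) {a : ℝ}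
    (hg : ∀ x, g x ≤ a * (1 + f x)) (ha : 0 ≤ a) : ∫⁻ x, ENNReal.ofReal (g x) ∂μ < ⊤ := by
  calc ∫⁻ x, ENNReal.ofReal (g x) ∂μ
      ≤ ∫⁻ x, ENNReal.ofReal a * (1 + ENNReal.ofReal (f x)) ∂μ := by
        refine lintegral_mono fun x => ?_
        refine (ENNReal.ofReal_le_ofReal (hg x)).trans ?_
        rw [ENNReal.ofReal_mul ha]
        gcongr
        simpa using ENNReal.ofReal_add_le (p := 1) (q := f x)
    _ = ENNReal.ofReal a * (μ Set.univ + ∫⁻ x, ENNReal.ofReal (f x) ∂μ) := by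
        rw [lintegral_const_mul' _ _ ENNReal.ofReal_ne_top, lintegral_add_left measurable_const,
          lintegral_const, one_mul]
    _ < ⊤ := ENNReal.mul_lt_top ENNReal.ofReal_lt_top
        (ENNReal.add_lt_top.2 ⟨measure_lt_top _ _, hf⟩)

end Comparison

/-- Moment and Hölder-regularity of the stationary measure `σ`:
it has a finite moment of some positive order `γ` and is `γ`-Hölder regular. -/
theorem stationary_measure_moment_and_holder
    (lam : Measure AffP) [IsProbabilityMeasure lam]
    (hmom : ∃ ε : ℝ, 0 < ε ∧
      ∫⁻ φ : AffP, ENNReal.ofReal (φ.1.1 ^ ε + φ.1.1 ^ (-ε) + |φ.1.2| ^ ε) ∂lam < ⊤)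
    (hnofix : ¬ ∃ t : ℝ, ∀ φ ∈ msupport lam, φ.1.1 * t + φ.1.2 = t)
    (σ : Measure ℝ) [IsProbabilityMeasure σ]
    (hstat : ∀ A : Set ℝ, MeasurableSet A →
      σ A = ∫⁻ φ : AffP, σ ((fun t => φ.1.1 * t + φ.1.2) ⁻¹' A) ∂lam) :
    ∃ γ : ℝ, 0 < γ ∧ ∃ C : ℝ, 0 < C ∧
      (∫⁻ s : ℝ, ENNReal.ofReal (|s| ^ γ) ∂σ < ⊤) ∧
      (∀ r : ℝ, 0 < r → ∀ s : ℝ, σ (Set.Icc (s - r) (s + r)) ≤ ENNReal.ofReal (C * r ^ γ)) := by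
  obtain ⟨ε, hε, hmom⟩ := hmom
  have h : IsAffStationary lam σ := hstat
  have hσ := h.measure_singleton_eq_zero hnofix
  have hr0 : ∀ (φ : AffP) (p : ℝ), 0 ≤ φ.1.1 ^ p := fun φ p => Real.rpow_nonneg (le_of_lt φ.2) p
  have hb0 : ∀ (φ : AffP) (p : ℝ), 0 ≤ |φ.1.2| ^ p := fun φ p => by positivity
  have hp : ∫⁻ φ : AffP, ENNReal.ofReal (φ.1.1 ^ ε) ∂lam < ⊤ :=
    lintegral_ofReal_lt_top_of_le hmom (a := 1)
      (fun φ => by linarith [hr0 φ (-ε), hb0 φ ε]) zero_le_one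
  have hn : ∫⁻ φ : AffP, ENNReal.ofReal (φ.1.1 ^ (-ε)) ∂lam < ⊤ :=
    lintegral_ofReal_lt_top_of_le hmom (a := 1)
      (fun φ => by linarith [hr0 φ ε, hb0 φ ε]) zero_le_one
  obtain ⟨γ, hγ0, hγ, hr⟩ := exists_lintegral_rpow_lt_one hε hp hn (h.integral_log_neg hnofix)
    (c := min 1 (ε / 2)) (by positivity)
  have hγ1 : γ ≤ 1 := hγ.trans (min_le_left _ _)
  have hγε : 2 * γ ≤ ε := by linarith [hγ.trans (min_le_right _ _)]
  have hb : ∫⁻ φ : AffP, ENNReal.ofReal (|φ.1.2| ^ γ) ∂lam < ⊤ :=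
    lintegral_ofReal_lt_top_of_le hmom (a := 1)
      (fun φ => by linarith [hr0 φ ε, hr0 φ (-ε),
        rpow_le_one_add_rpow (abs_nonneg φ.1.2) hγ0.le (show γ ≤ ε by linarith)]) zero_le_one
  have hB : ∫⁻ φ : AffP, ENNReal.ofReal (φ.1.1 ^ (-γ)) ∂lam < ⊤ :=
    lintegral_ofReal_lt_top_of_le hn (a := 1) (fun φ => by
      have hφ := φ.2
      rw [Real.rpow_neg hφ.le, Real.rpow_neg hφ.le, ← Real.inv_rpow hφ.le, ← Real.inv_rpow hφ.le,
        one_mul]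
      exact rpow_le_one_add_rpow (by positivity) hγ0.le (by linarith)) zero_le_one
  have hD : ∫⁻ φ : AffP, ENNReal.ofReal ((1 + φ.1.1 + |φ.1.2|) ^ (2 * γ)) ∂lam < ⊤ :=
    lintegral_ofReal_lt_top_of_le hmom (a := 3 ^ ε) (fun φ => by
      have hφ := φ.2
      calc (1 + φ.1.1 + |φ.1.2|) ^ (2 * γ) ≤ (1 + φ.1.1 + |φ.1.2|) ^ ε :=
            Real.rpow_le_rpow_of_exponent_le (by linarith [abs_nonneg φ.1.2]) hγε
        _ ≤ 3 ^ ε * (1 + φ.1.1 ^ ε + |φ.1.2| ^ ε) :=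
            one_add_add_rpow_le hφ.le (abs_nonneg _) hε.le
        _ ≤ _ := by
            refine mul_le_mul_of_nonneg_left ?_ (by positivity)
            linarith [hr0 φ (-ε)]) (by positivity)
  have hmoment := h.lintegral_abs_rpow_lt_top hγ0 hγ1 hr hb
  have hC : 1 + ∫⁻ s, ENNReal.ofReal ((2 * (1 + |s|)) ^ γ) ∂σ ≠ ⊤ := by
    refine ENNReal.add_ne_top.2 ⟨ENNReal.one_ne_top,
      (lintegral_ofReal_lt_top_of_le hmoment (a := 2 ^ γ) (fun s => ?_) (by positivity)).ne⟩
    rw [Real.mul_rpow two_pos.le (by positivity)]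
    gcongr
    simpa using Real.rpow_add_le_add_rpow zero_le_one (abs_nonneg s) hγ0.le hγ1
  obtain ⟨N, hN⟩ := h.exists_iterate_decayWeight_le_half hσ hγ0 hγ1 hr hD
  obtain ⟨γ', hγpos', hγ'γ, C', hCpos', hC'⟩ := exists_measure_Icc_le_rpow hγ0 hC
    (ENNReal.pow_ne_top hB.ne (n := N)) fun k y t ht =>
      (h.measure_Icc_le_iterate (measurable_decayWeight γ) hC le_rfl
        (fun y t _ => measure_Icc_le_decayWeight hγ0 y t) (N * k) y t ht).trans (by
          rw [pow_mul]
          gcongr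
          exact (iterate_mul_backwardOp_le (by simp) hN k y).trans
            (mul_le_of_le_one_right' (decayWeight_le_one hγ0.le y)))
  exact ⟨γ', hγpos', C', hCpos', lintegral_ofReal_lt_top_of_le hmoment (a := 1)
    (fun s => by simpa using rpow_le_one_add_rpow (abs_nonneg s) hγpos'.le hγ'γ) zero_le_one, hC'⟩
end

section
/- Under the standing assumptions, there exist ε > 0 and C > 0 such that for every n ≥ 0 and every bounded Lipschitz function f : ℝ → ℝ, |∫ f dσ^{(n)} − ∫ f dσ| ≤ C e^{−εn} ‖f‖_Lip, where ‖f‖_Lip = sup|f| + (the Lipschitz constant of f). -/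
open MeasureTheory Filter Topology

/-- `iterLaw lam n` is the law `σ⁽ⁿ⁾` of `(φ₁ ∘ ⋯ ∘ φₙ)(0)` where `φ₁, …, φₙ` are
i.i.d. with law `lam`; `iterLaw lam 0 = δ₀`. -/
noncomputable def iterLaw (lam : Measure AffP) : ℕ → Measure ℝ
  | 0 => Measure.dirac 0
  | n + 1 =>
      Measure.map (fun p : AffP × ℝ => p.1.1.1 * p.2 + p.1.1.2) (lam.prod (iterLaw lam n))

section ScalarIncrement

/-- If `H` has limiting value `l` along `F` then its integral over a translated window of
length `x` tends to `l * x`. -/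
theorem tendsto_intervalIntegral_translate {F : Filter ℝ} [F.IsCountablyGenerated]
    {H : ℝ → ℝ} (hc : Continuous H) {M : ℝ} (hM : ∀ u, |H u| ≤ M) {l : ℝ}
    (hl : ∀ y, Tendsto (fun T => H (T + y)) F (𝓝 l)) (x : ℝ) :
    Tendsto (fun T => ∫ u in T..(T + x), H u) F (𝓝 (l * x)) := by
  have h1 : ∀ T, ∫ u in T..(T + x), H u = ∫ y in (0 : ℝ)..x, H (T + y) := by
    intro T
    rw [intervalIntegral.integral_comp_add_left (fun u => H u) T, add_zero]
  have h2 : l * x = ∫ _ in (0 : ℝ)..x, l := by simp [mul_comm]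
  simp_rw [h1]
  rw [h2]
  refine intervalIntegral.tendsto_integral_filter_of_dominated_convergence (fun _ => M)
    (Eventually.of_forall fun T => ?_) (Eventually.of_forall fun T => ?_) (by simp)
    (Eventually.of_forall fun y _ => hl y)
  · exact Continuous.aestronglyMeasurable (by fun_prop)
  · exact Eventually.of_forall fun y _ => hM _

/-- If `A` has derivative `H - A` and `A → a` at infinity, then windowed integrals of `H` of length `x` tend to
`a * x`. -/
theorem tendsto_intervalIntegral_of_hasDerivAt_sub {H A : ℝ → ℝ} (hH : Continuous H)
    {M : ℝ} (hM : ∀ u, |A u| ≤ M) {a : ℝ} (hA : Tendsto A atTop (𝓝 a))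
    (hd : ∀ u, HasDerivAt A (H u - A u) u) (x : ℝ) :
    Tendsto (fun T => ∫ u in T..(T + x), H u) atTop (𝓝 (a * x)) := by
  have hAc : Continuous A := continuous_iff_continuousAt.2 fun u => (hd u).continuousAt
  have h1 : ∀ T, ∫ u in T..(T + x), H u = (A (T + x) - A T) + ∫ u in T..(T + x), A u := by
    intro T
    rw [← intervalIntegral.integral_eq_sub_of_hasDerivAt (fun u _ => hd u)
      ((hH.sub hAc).intervalIntegrable _ _), intervalIntegral.integral_sub
      (hH.intervalIntegrable _ _) (hAc.intervalIntegrable _ _)]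
    ring
  have hs : ∀ y, Tendsto (fun T => A (T + y)) atTop (𝓝 a) := fun y =>
    hA.comp (tendsto_atTop_add_const_right _ y tendsto_id)
  simp_rw [h1]
  simpa using ((hs x).sub hA).add (tendsto_intervalIntegral_translate hAc hM hs x)

variable {Ω : Type*} [MeasurableSpace Ω] {P : Measure Ω} [IsProbabilityMeasure P]
  {s : Ω → ℝ} {H : ℝ → ℝ}

theorem intervalIntegral_increment_eq (hs : Measurable s) (hc : Continuous H)
    (hH : ∀ u, |H u| ≤ 1) (T : ℝ) :
    ∫ u in (-T)..T, ((∫ ω, H (u + s ω) ∂P) - H u) =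
      ∫ ω, ((∫ u in T..(T + s ω), H u) - ∫ u in (-T)..(-T + s ω), H u) ∂P := by
  have hi : ∀ u, Integrable (fun ω => H (u + s ω)) P := fun u =>
    Integrable.of_bound (C := 1) (by fun_prop) (Eventually.of_forall fun ω => hH _)
  have h1 : ∀ u, (∫ ω, H (u + s ω) ∂P) - H u = ∫ ω, (H (u + s ω) - H u) ∂P := by
    intro u
    rw [integral_sub (hi u) (integrable_const _)]
    simp
  simp_rw [h1]
  rw [intervalIntegral_integral_swap]
  · refine integral_congr_ae (Eventually.of_forall fun ω => ?_)
    have hci : ∀ a b, IntervalIntegrable H volume a b := fun a b => hc.intervalIntegrable a b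
    have h2 : ∫ u in (-T)..T, H (u + s ω) = ∫ u in (-T + s ω)..(T + s ω), H u :=
      intervalIntegral.integral_comp_add_right (fun u => H u) (s ω)
    have h3 := intervalIntegral.integral_add_adjacent_intervals (hci (-T) T) (hci T (T + s ω))
    have h4 := intervalIntegral.integral_add_adjacent_intervals (hci (-T) (-T + s ω))
      (hci (-T + s ω) (T + s ω))
    have h5 : ∫ u in (-T)..T, (H (u + s ω) - H u) =
        (∫ u in (-T)..T, H (u + s ω)) - ∫ u in (-T)..T, H u :=
      intervalIntegral.integral_sub (Continuous.intervalIntegrable (by fun_prop) _ _) (hci _ _)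
    simp only [h5, h2]
    linarith
  · have : IsFiniteMeasure (volume.restrict (Set.uIoc (-T) T)) := ⟨by simp [Set.uIoc]⟩
    refine Integrable.of_bound (C := 2) ?_ (Eventually.of_forall fun p => ?_)
    · have hm := hc.measurable
      exact Measurable.aestronglyMeasurable (by unfold Function.uncurry; fun_prop)
    · simp only [Function.uncurry, Real.norm_eq_abs]
      have := abs_sub (H (p.1 + s p.2)) (H p.1)
      linarith [hH (p.1 + s p.2), hH p.1]

theorem tendsto_intervalIntegral_increment (hsm : Measurable s) (hs : Integrable s P)
    (hc : Continuous H) (hH : ∀ u, |H u| ≤ 1) (hbot : Tendsto H atBot (𝓝 1)) {a : ℝ}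
    (htop : ∀ x, Tendsto (fun T => ∫ u in T..(T + x), H u) atTop (𝓝 (a * x))) :
    Tendsto (fun T => ∫ u in (-T)..T, ((∫ ω, H (u + s ω) ∂P) - H u)) atTop
      (𝓝 ((a - 1) * ∫ ω, s ω ∂P)) := by
  simp_rw [intervalIntegral_increment_eq hsm hc hH]
  rw [← integral_const_mul]
  have hb : ∀ T x : ℝ, |∫ u in T..(T + x), H u| ≤ |x| := by
    intro T x
    simpa using intervalIntegral.norm_integral_le_of_norm_le_const (a := T) (b := T + x)
      (f := H) (C := 1) (fun u _ => hH u)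
  have hm : ∀ T : ℝ, Measurable fun x : ℝ => ∫ u in T..(T + x), H u := by
    intro T
    have : Continuous fun y : ℝ => ∫ u in T..y, H u :=
      intervalIntegral.continuous_primitive (fun a b => hc.intervalIntegrable a b) T
    exact (this.comp (continuous_const.add continuous_id)).measurable
  refine tendsto_integral_filter_of_dominated_convergence (fun ω => 2 * |s ω|)
    (Eventually.of_forall fun T => ?_) (Eventually.of_forall fun T => ?_)
    (hs.abs.const_mul 2) (Eventually.of_forall fun ω => ?_)
  · exact (((hm T).comp hsm).sub ((hm (-T)).comp hsm)).aestronglyMeasurable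
  · refine Eventually.of_forall fun ω => ?_
    rw [Real.norm_eq_abs]
    have := abs_sub (∫ u in T..(T + s ω), H u) (∫ u in (-T)..(-T + s ω), H u)
    linarith [hb T (s ω), hb (-T) (s ω)]
  · have h1 : Tendsto (fun T => ∫ u in (-T)..(-T + s ω), H u) atTop (𝓝 (1 * s ω)) :=
      (tendsto_intervalIntegral_translate hc hH (fun y => hbot.comp
        (tendsto_atBot_add_const_right _ y tendsto_id)) (s ω)).comp tendsto_neg_atTop_atBot
    have := (htop (s ω)).sub h1
    rwa [← sub_mul] at this

/-- A bounded continuous `H` which is subharmonic for a random walk with nonnegative drift and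
is larger at `-∞` than on average at `+∞` is harmonic. -/
theorem integral_increment_eq_zero_of_drift_nonneg (hsm : Measurable s) (hs : Integrable s P)
    (hc : Continuous H) (hH : ∀ u, |H u| ≤ 1) (hbot : Tendsto H atBot (𝓝 1)) {a : ℝ}
    (htop : ∀ x, Tendsto (fun T => ∫ u in T..(T + x), H u) atTop (𝓝 (a * x)))
    (ha : a ≤ 1) (hsub : ∀ u, H u ≤ ∫ ω, H (u + s ω) ∂P) (hdrift : 0 ≤ ∫ ω, s ω ∂P) (u : ℝ) :
    ∫ ω, H (u + s ω) ∂P = H u := by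
  have hlim := tendsto_intervalIntegral_increment hsm hs hc hH hbot htop
  set v : ℝ → ℝ := fun u => (∫ ω, H (u + s ω) ∂P) - H u with hv
  have hvc : Continuous v := by
    refine Continuous.sub (continuous_of_dominated (bound := fun _ => 1) ?_ ?_ ?_ ?_) hc
    · exact fun x => by fun_prop
    · exact fun x => Eventually.of_forall fun ω => hH _
    · exact integrable_const _
    · exact Eventually.of_forall fun ω => by fun_prop
  have hv0 : ∀ x, 0 ≤ v x := fun x => sub_nonneg.2 (hsub x)
  by_contra hne
  have hpos : 0 < v u := lt_of_le_of_ne (hv0 u) fun h => hne (sub_eq_zero.1 h.symm)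
  set R : ℝ := |u| + 1
  have hI : 0 < ∫ x in (-R)..R, v x := by
    have hR : -R < R := by simp only [R]; linarith [abs_nonneg u]
    refine intervalIntegral.integral_pos hR hvc.continuousOn (fun x _ => hv0 x) ⟨u, ?_, hpos⟩
    constructor <;> simp only [R] <;> linarith [neg_abs_le u, le_abs_self u]
  have hge : ∫ x in (-R)..R, v x ≤ (a - 1) * ∫ ω, s ω ∂P := by
    refine ge_of_tendsto hlim ?_
    filter_upwards [eventually_ge_atTop R] with T hT
    refine intervalIntegral.integral_mono_interval (by linarith) ?_ hT
      (Eventually.of_forall hv0) (hvc.intervalIntegrable _ _)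
    simp only [R]; linarith [abs_nonneg u]
  nlinarith

end ScalarIncrement

section Wiener

open Real in
theorem tendsto_integral_sinc_mul (μ : Measure ℝ) [IsFiniteMeasure μ] :
    Tendsto (fun X : ℝ => ∫ w, sinc (X * w) ∂μ) atTop (𝓝 (μ.real {0})) := by
  have h0 : μ.real {0} = ∫ w, Set.indicator {0} (fun _ => (1 : ℝ)) w ∂μ := by
    rw [integral_indicator (measurableSet_singleton 0)]
    simp [Measure.real]
  rw [h0]
  refine tendsto_integral_filter_of_dominated_convergence (fun _ => 1)
    (Eventually.of_forall fun X => ?_) (Eventually.of_forall fun X => ?_) (integrable_const _)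
    (Eventually.of_forall fun w => ?_)
  · exact (continuous_sinc.comp (by fun_prop)).aestronglyMeasurable
  · exact Eventually.of_forall fun w => abs_sinc_le_one _
  · by_cases hw : w = 0
    · simp [hw]
    · have hlim : Tendsto (fun X : ℝ => |w|⁻¹ * X⁻¹) atTop (𝓝 0) := by
        simpa using tendsto_inv_atTop_zero.const_mul |w|⁻¹
      simp only [Set.mem_singleton_iff, hw, not_false_eq_true, Set.indicator_of_notMem]
      refine squeeze_zero_norm' ?_ hlim
      filter_upwards [eventually_gt_atTop 0] with X hX
      rw [sinc_of_ne_zero (mul_ne_zero hX.ne' hw), norm_eq_abs, abs_div, abs_mul, abs_of_pos hX,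
        ← mul_inv, mul_comm |w|, div_eq_mul_inv]
      exact mul_le_of_le_one_left (by positivity) (abs_sin_le_one _)

variable (σ : Measure ℝ) [IsProbabilityMeasure σ]

theorem charFun_map_sub_prod (t : ℝ) :
    charFun ((σ.prod σ).map (fun p : ℝ × ℝ => p.1 - p.2)) t = ((‖charFun σ t‖ ^ 2 : ℝ) : ℂ) := by
  rw [charFun_apply_real, integral_map (by fun_prop)
    (Continuous.aestronglyMeasurable (by fun_prop))]
  have h1 : ∀ p : ℝ × ℝ, Complex.exp (t * ((p.1 - p.2 : ℝ) : ℂ) * Complex.I) =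
      Complex.exp (t * p.1 * Complex.I) * Complex.exp ((-t : ℝ) * p.2 * Complex.I) := by
    intro p
    rw [← Complex.exp_add]
    push_cast
    ring_nf
  simp_rw [h1]
  rw [integral_prod_mul (μ := σ) (ν := σ) (fun x : ℝ => Complex.exp (t * x * Complex.I))
    (fun y : ℝ => Complex.exp ((-t : ℝ) * y * Complex.I)), ← charFun_apply_real,
    ← charFun_apply_real, charFun_neg, Complex.mul_conj, Complex.normSq_eq_norm_sq]

theorem continuous_norm_charFun_sq : Continuous fun t => ‖charFun σ t‖ ^ 2 :=
  continuous_charFun.norm.pow 2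

theorem intervalIntegral_norm_charFun_sq {X : ℝ} (hX : 0 < X) :
    ∫ t in (0 : ℝ)..X, ‖charFun σ t‖ ^ 2 =
      X * ∫ w, Real.sinc (X * w) ∂((σ.prod σ).map (fun p : ℝ × ℝ => p.1 - p.2)) := by
  have hi : ∀ a b, IntervalIntegrable (fun t => ‖charFun σ t‖ ^ 2) volume a b := fun a b =>
    (continuous_norm_charFun_sq σ).intervalIntegrable a b
  have : IsProbabilityMeasure ((σ.prod σ).map (fun p : ℝ × ℝ => p.1 - p.2)) :=
    Measure.isProbabilityMeasure_map (by fun_prop)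
  have h := integral_charFun_Icc (μ := (σ.prod σ).map (fun p : ℝ × ℝ => p.1 - p.2)) hX
  simp_rw [charFun_map_sub_prod] at h
  rw [intervalIntegral.integral_ofReal] at h
  have h2 : ∫ t in (-X)..X, ‖charFun σ t‖ ^ 2 =
      2 * X * ∫ w, Real.sinc (X * w) ∂((σ.prod σ).map (fun p : ℝ × ℝ => p.1 - p.2)) := by
    exact_mod_cast h
  have h3 : ∫ t in (-X)..0, ‖charFun σ t‖ ^ 2 = ∫ t in (0 : ℝ)..X, ‖charFun σ t‖ ^ 2 := by
    have := intervalIntegral.integral_comp_neg (a := 0) (b := X) (fun t => ‖charFun σ t‖ ^ 2)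
    simpa [charFun_neg] using this.symm
  have h4 := intervalIntegral.integral_add_adjacent_intervals (hi (-X) 0) (hi 0 X)
  linarith

theorem tendsto_logarithmic_mean_norm_charFun_sq (x : ℝ) :
    Tendsto (fun T => ∫ u in T..(T + x), ‖charFun σ (Real.exp u)‖ ^ 2) atTop
      (𝓝 (((σ.prod σ).map (fun p : ℝ × ℝ => p.1 - p.2)).real {0} * x)) := by
  set μ := (σ.prod σ).map (fun p : ℝ × ℝ => p.1 - p.2)
  have : IsProbabilityMeasure μ := Measure.isProbabilityMeasure_map (by fun_prop)
  have hc := continuous_norm_charFun_sq σ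
  refine tendsto_intervalIntegral_of_hasDerivAt_sub (hc.comp Real.continuous_exp)
    (A := fun u => ∫ w, Real.sinc (Real.exp u * w) ∂μ) (M := 1) (fun u => ?_)
    ((tendsto_integral_sinc_mul μ).comp Real.tendsto_exp_atTop) (fun u => ?_) x
  · simpa using norm_integral_le_of_norm_le_const (μ := μ) (C := 1)
      (f := fun w => Real.sinc (Real.exp u * w))
      (Eventually.of_forall fun w => Real.abs_sinc_le_one (Real.exp u * w))
  · have hA : (fun u => ∫ w, Real.sinc (Real.exp u * w) ∂μ) =
        fun u => Real.exp (-u) * ∫ t in (0 : ℝ)..Real.exp u, ‖charFun σ t‖ ^ 2 := by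
      funext u
      rw [intervalIntegral_norm_charFun_sq σ (Real.exp_pos u), ← mul_assoc, ← Real.exp_add]
      simp [μ]
    have hG : HasDerivAt (fun u => ∫ t in (0 : ℝ)..Real.exp u, ‖charFun σ t‖ ^ 2)
        (‖charFun σ (Real.exp u)‖ ^ 2 * Real.exp u) u :=
      (intervalIntegral.integral_hasDerivAt_right (hc.intervalIntegrable _ _)
        (hc.stronglyMeasurableAtFilter _ _) hc.continuousAt).comp u (Real.hasDerivAt_exp u)
    have hE : HasDerivAt (fun u => Real.exp (-u)) (-Real.exp (-u)) u := by
      simpa using (hasDerivAt_neg u).exp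
    have hval := congrFun hA u
    beta_reduce at hval
    rw [hval, hA]
    refine (hE.mul hG).congr_deriv ?_
    simp only [Function.comp_apply]
    have : Real.exp (-u) * Real.exp u = 1 := by rw [← Real.exp_add]; simp
    linear_combination (‖charFun σ (Real.exp u)‖ ^ 2) * this

end Wiener

theorem exists_measure_singleton_eq_one (σ : Measure ℝ) [IsProbabilityMeasure σ]
    (h : 1 ≤ ((σ.prod σ).map (fun p : ℝ × ℝ => p.1 - p.2)).real {0}) :
    ∃ y, σ {y} = 1 := by
  have hpre : ((σ.prod σ).map (fun p : ℝ × ℝ => p.1 - p.2)) {0} = ∫⁻ x, σ {x} ∂σ := by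
    rw [Measure.map_apply (by fun_prop) (measurableSet_singleton 0),
      Measure.prod_apply (measurableSet_preimage (by fun_prop) (measurableSet_singleton 0))]
    congr with x
    congr 1
    ext y
    simp [sub_eq_zero, eq_comm]
  have : IsProbabilityMeasure ((σ.prod σ).map (fun p : ℝ × ℝ => p.1 - p.2)) :=
    Measure.isProbabilityMeasure_map (by fun_prop)
  have h1 : ∫⁻ x, σ {x} ∂σ = 1 := by
    rw [← hpre, ← ENNReal.ofReal_toReal (measure_ne_top _ {0}), ← Measure.real,
      le_antisymm measureReal_le_one h, ENNReal.ofReal_one]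
  by_contra! hne
  have hlt : ∀ x, σ {x} < 1 := fun x => lt_of_le_of_ne prob_le_one (hne x)
  have : ∫⁻ x, σ {x} ∂σ < ∫⁻ _, 1 ∂σ :=
    lintegral_strict_mono (IsProbabilityMeasure.ne_zero σ) aemeasurable_const (by simp [h1])
      (Eventually.of_forall hlt)
  simp [h1] at this

theorem integral_norm_sub_integral_sq {Ω E : Type*} [MeasurableSpace Ω] {P : Measure Ω}
    [IsProbabilityMeasure P] [NormedAddCommGroup E] [InnerProductSpace ℝ E] [CompleteSpace E]
    {z : Ω → E} (hz : MemLp z 2 P) :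
    ∫ ω, ‖z ω - ∫ ω', z ω' ∂P‖ ^ 2 ∂P = (∫ ω, ‖z ω‖ ^ 2 ∂P) - ‖∫ ω, z ω ∂P‖ ^ 2 := by
  set c := ∫ ω, z ω ∂P with hc
  have hi : Integrable z P := hz.integrable (by norm_num)
  have h2 : Integrable (fun ω => ‖z ω‖ ^ 2) P := hz.integrable_norm_pow (by norm_num)
  have hin : Integrable (fun ω => 2 * inner ℝ c (z ω)) P := (hi.const_inner c).const_mul 2
  have h1 : ∀ ω, ‖z ω - c‖ ^ 2 = ‖z ω‖ ^ 2 - 2 * inner ℝ c (z ω) + ‖c‖ ^ 2 := fun ω => by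
    rw [norm_sub_sq_real, real_inner_comm]
  simp_rw [h1]
  rw [integral_add (f := fun ω => ‖z ω‖ ^ 2 - 2 * inner ℝ c (z ω)) (h2.sub hin)
    (integrable_const _), integral_sub h2 hin, integral_const_mul,
    integral_inner hi, ← hc, real_inner_self_eq_norm_sq]
  simp only [integral_const, probReal_univ, one_smul]
  ring

theorem forall_mem_msupport_of_ae {α : Type*} [TopologicalSpace α] [MeasurableSpace α]
    {μ : Measure α} {p : α → Prop} (hp : IsClosed {x | p x}) (h : ∀ᵐ x ∂μ, p x) :
    ∀ x ∈ msupport μ, p x := by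
  intro x hx
  by_contra hpx
  exact (hx _ hp.isOpen_compl hpx).ne' (ae_iff.1 h)

section Drift

variable {lam : Measure AffP} {σ : Measure ℝ} [IsProbabilityMeasure σ]

theorem measurable_affine_action :
    Measurable fun p : AffP × ℝ => p.1.1.1 * p.2 + p.1.1.2 := by
  fun_prop

theorem eq_map_of_stationary (hstat : ∀ A : Set ℝ, MeasurableSet A →
      σ A = ∫⁻ φ : AffP, σ ((fun t => φ.1.1 * t + φ.1.2) ⁻¹' A) ∂lam) :
    σ = (lam.prod σ).map (fun p : AffP × ℝ => p.1.1.1 * p.2 + p.1.1.2) := by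
  ext A hA
  rw [hstat A hA, Measure.map_apply measurable_affine_action hA,
    Measure.prod_apply (measurable_affine_action hA)]
  rfl

theorem integral_of_eq_map [IsProbabilityMeasure lam] {E : Type*} [NormedAddCommGroup E]
    [NormedSpace ℝ E]
    {μ ν : Measure ℝ} [IsProbabilityMeasure μ]
    (hν : ν = (lam.prod μ).map (fun p : AffP × ℝ => p.1.1.1 * p.2 + p.1.1.2))
    {f : ℝ → E} (hf : StronglyMeasurable f) {B : ℝ} (hB : ∀ x, ‖f x‖ ≤ B) :
    ∫ x, f x ∂ν = ∫ φ : AffP, ∫ x, f (φ.1.1 * x + φ.1.2) ∂μ ∂lam := by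
  rw [hν, integral_map measurable_affine_action.aemeasurable hf.aestronglyMeasurable,
    integral_prod]
  exact Integrable.of_bound (hf.comp_measurable measurable_affine_action).aestronglyMeasurable
    B (Eventually.of_forall fun p => hB _)

theorem charFun_eq_of_stationary [IsProbabilityMeasure lam]
    (hσ : σ = (lam.prod σ).map (fun p : AffP × ℝ => p.1.1.1 * p.2 + p.1.1.2)) (t : ℝ) :
    charFun σ t =
      ∫ φ : AffP, Complex.exp ((t * φ.1.2 : ℝ) * Complex.I) * charFun σ (t * φ.1.1) ∂lam := by
  rw [charFun_apply_real, integral_of_eq_map hσ (B := 1)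
    (Continuous.stronglyMeasurable (by fun_prop))]
  · refine integral_congr_ae (Eventually.of_forall fun φ => ?_)
    simp only [charFun_apply_real]
    rw [← integral_const_mul]
    congr with x
    rw [← Complex.exp_add]
    push_cast
    ring_nf
  · intro x
    rw [← Complex.ofReal_mul, Complex.norm_exp_ofReal_mul_I]

theorem ae_fixes_of_singleton_eq_one
    (hσ : σ = (lam.prod σ).map (fun p : AffP × ℝ => p.1.1.1 * p.2 + p.1.1.2)) {y : ℝ}
    (hy : σ {y} = 1) : ∀ᵐ φ : AffP ∂lam, φ.1.1 * y + φ.1.2 = y := by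
  have h1 : ∀ᵐ x ∂σ, x = y := by
    have := (prob_compl_eq_zero_iff (measurableSet_singleton y)).2 hy
    exact this
  have h2 : ∀ᵐ p ∂(lam.prod σ), p.1.1.1 * p.2 + p.1.1.2 = y := by
    have h1' := h1
    rw [hσ] at h1'
    exact ae_of_ae_map measurable_affine_action.aemeasurable h1'
  filter_upwards [Measure.ae_ae_of_ae_prod h2] with φ hφ
  obtain ⟨x, hx1, hx2⟩ := (h1.and hφ).exists
  rwa [hx1] at hx2

theorem tendsto_norm_charFun_exp_sq_atBot (σ : Measure ℝ) [IsProbabilityMeasure σ] :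
    Tendsto (fun u => ‖charFun σ (Real.exp u)‖ ^ 2) atBot (𝓝 1) := by
  simpa [Function.comp_def] using
    ((continuous_norm_charFun_sq σ).tendsto 0).comp Real.tendsto_exp_atBot

theorem eq_one_of_periodic_of_tendsto_atBot {H : ℝ → ℝ} (hbot : Tendsto H atBot (𝓝 1)) {s : ℝ}
    (hs : s ≠ 0) (hper : ∀ u, H (u + s) = H u) (u : ℝ) : H u = 1 := by
  wlog h : s < 0 generalizing s
  · exact this (neg_ne_zero.2 hs) (fun v => by simpa using (hper (v + -s)).symm)
      (neg_neg_of_pos (lt_of_le_of_ne (not_lt.1 h) hs.symm))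
  have hn : ∀ n : ℕ, H (u + n * s) = H u := by
    intro n
    induction n with
    | zero => simp
    | succ n ih => rw [← ih, ← hper (u + n * s)]; push_cast; ring_nf
  have ht : Tendsto (fun n : ℕ => u + n * s) atTop atBot :=
    tendsto_atBot_add_const_left _ _ (tendsto_natCast_atTop_atTop.atTop_mul_const_of_neg h)
  have := hbot.comp ht
  simp only [Function.comp_def, hn] at this
  exact tendsto_nhds_unique tendsto_const_nhds this

/-- If the drift is nonnegative then almost every map preserves the stationary measure
(expressed through characteristic functions). -/
theorem ae_charFun_eq_of_drift_nonneg [IsProbabilityMeasure lam]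
    (hσ : σ = (lam.prod σ).map (fun p : AffP × ℝ => p.1.1.1 * p.2 + p.1.1.2))
    (hlog : Integrable (fun φ : AffP => Real.log φ.1.1) lam)
    (hdrift : 0 ≤ ∫ φ : AffP, Real.log φ.1.1 ∂lam) :
    ∀ᵐ φ : AffP ∂lam, ∀ u : ℝ, Complex.exp ((Real.exp u * φ.1.2 : ℝ) * Complex.I) *
      charFun σ (Real.exp u * φ.1.1) = charFun σ (Real.exp u) := by
  have hcc : Continuous (charFun σ) := continuous_charFun
  let z : ℝ → AffP → ℂ := fun t φ =>
    Complex.exp ((t * φ.1.2 : ℝ) * Complex.I) * charFun σ (t * φ.1.1)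
  have hzn : ∀ t φ, ‖z t φ‖ = ‖charFun σ (t * φ.1.1)‖ := fun t φ => by
    simp only [z, norm_mul, Complex.norm_exp_ofReal_mul_I, one_mul]
  have hzc : ∀ t, Continuous (z t) := fun t => by
    simp only [z]
    fun_prop
  have hzL : ∀ t, MemLp (z t) 2 lam := fun t =>
    MemLp.of_bound (hzc t).aestronglyMeasurable 1 (Eventually.of_forall fun φ => by
      rw [hzn]; exact norm_charFun_le_one _)
  have hvar : ∀ t, ∫ φ, ‖z t φ - charFun σ t‖ ^ 2 ∂lam =
      (∫ φ : AffP, ‖charFun σ (t * φ.1.1)‖ ^ 2 ∂lam) - ‖charFun σ t‖ ^ 2 := fun t => by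
    have h := integral_norm_sub_integral_sq (hzL t)
    rw [← charFun_eq_of_stationary hσ t] at h
    simpa only [hzn] using h
  have hexp : ∀ u (φ : AffP), Real.exp (u + Real.log φ.1.1) = Real.exp u * φ.1.1 := fun u φ => by
    rw [Real.exp_add, Real.exp_log φ.2]
  have hharm : ∀ u, ∫ φ : AffP, ‖charFun σ (Real.exp u * φ.1.1)‖ ^ 2 ∂lam =
      ‖charFun σ (Real.exp u)‖ ^ 2 := by
    have : IsProbabilityMeasure ((σ.prod σ).map (fun p : ℝ × ℝ => p.1 - p.2)) :=
      Measure.isProbabilityMeasure_map (by fun_prop)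
    have h := integral_increment_eq_zero_of_drift_nonneg
      (H := fun u => ‖charFun σ (Real.exp u)‖ ^ 2)
      (s := fun φ : AffP => Real.log φ.1.1) (by fun_prop) hlog
      (by fun_prop) (fun u => ?_) (tendsto_norm_charFun_exp_sq_atBot σ)
      (tendsto_logarithmic_mean_norm_charFun_sq σ) measureReal_le_one (fun u => ?_) hdrift
    · simpa only [hexp] using h
    · rw [abs_of_nonneg (by positivity)]
      exact pow_le_one₀ (norm_nonneg _) (norm_charFun_le_one _)
    · simp only [hexp]
      rw [← sub_nonneg, ← hvar]
      exact integral_nonneg fun φ => by positivity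
  have hae : ∀ u, ∀ᵐ φ ∂lam, z (Real.exp u) φ = charFun σ (Real.exp u) := by
    intro u
    have h0 := hvar (Real.exp u)
    rw [hharm, sub_self, integral_eq_zero_iff_of_nonneg
      (f := fun φ => ‖z (Real.exp u) φ - charFun σ (Real.exp u)‖ ^ 2) (fun φ => by positivity)
      (((hzL _).sub (memLp_const _)).integrable_norm_pow (by norm_num))] at h0
    filter_upwards [h0] with φ hφ
    simpa [sub_eq_zero] using hφ
  have hq : ∀ᵐ φ ∂lam, ∀ q : ℚ, z (Real.exp q) φ = charFun σ (Real.exp q) :=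
    ae_all_iff.2 fun q => hae q
  filter_upwards [hq] with φ hφ
  have hzu : Continuous fun u : ℝ => z (Real.exp u) φ := by
    simp only [z]
    fun_prop
  exact fun u => congrFun ((Rat.denseRange_cast (𝕜 := ℝ)).equalizer hzu
    (hcc.comp Real.continuous_exp) (funext hφ)) u

/-- An affine map preserving a non-Dirac probability measure is the identity. -/
theorem eq_id_of_charFun_eq {r b : ℝ} (hr : 0 < r) (hσ : ¬ ∃ y, σ {y} = 1)
    (h : ∀ u : ℝ, Complex.exp ((Real.exp u * b : ℝ) * Complex.I) *
      charFun σ (Real.exp u * r) = charFun σ (Real.exp u)) : r = 1 ∧ b = 0 := by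
  have hbot := tendsto_norm_charFun_exp_sq_atBot σ
  have hr1 : r = 1 := by
    by_contra hne
    have hper : ∀ u, ‖charFun σ (Real.exp (u + Real.log r))‖ ^ 2 =
        ‖charFun σ (Real.exp u)‖ ^ 2 := fun u => by
      rw [Real.exp_add, Real.exp_log hr, ← h u, norm_mul, Complex.norm_exp_ofReal_mul_I, one_mul]
    have h1 := eq_one_of_periodic_of_tendsto_atBot hbot
      (Real.log_ne_zero_of_pos_of_ne_one hr hne) hper
    have h2 := tendsto_logarithmic_mean_norm_charFun_sq σ 1
    simp_rw [h1] at h2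
    have h3 := tendsto_nhds_unique h2 (b := 1) (by simp)
    exact hσ (exists_measure_singleton_eq_one σ (by linarith))
  refine ⟨hr1, ?_⟩
  by_contra hb
  have h1 : ∀ᶠ u in atBot, 0 < ‖charFun σ (Real.exp u)‖ ^ 2 :=
    hbot.eventually (lt_mem_nhds one_pos)
  have h2 : ∀ᶠ u in atBot, |Real.exp u * b| < Real.pi := by
    have : Tendsto (fun u => |Real.exp u * b|) atBot (𝓝 0) := by
      simpa using (Real.tendsto_exp_atBot.mul_const b).abs
    exact this.eventually (gt_mem_nhds Real.pi_pos)
  obtain ⟨u, hu1, hu2⟩ := (h1.and h2).exists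
  have hne : charFun σ (Real.exp u) ≠ 0 := fun h0 => by simp [h0] at hu1
  have hu := h u
  rw [hr1, mul_one] at hu
  have hexp := mul_right_cancel₀ hne (hu.trans (one_mul _).symm)
  have hsin : Real.sin (Real.exp u * b) = 0 := by
    rw [← Complex.exp_ofReal_mul_I_im, hexp, Complex.one_im]
  rw [Real.sin_eq_zero_iff_of_lt_of_lt (abs_lt.1 hu2).1 (abs_lt.1 hu2).2] at hsin
  exact hb ((mul_eq_zero.1 hsin).resolve_left (Real.exp_pos u).ne')

theorem integral_log_neg_of_stationary [IsProbabilityMeasure lam]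
    (hσ : σ = (lam.prod σ).map (fun p : AffP × ℝ => p.1.1.1 * p.2 + p.1.1.2))
    (hnofix : ¬ ∃ t : ℝ, ∀ φ ∈ msupport lam, φ.1.1 * t + φ.1.2 = t)
    (hlog : Integrable (fun φ : AffP => Real.log φ.1.1) lam) :
    ∫ φ : AffP, Real.log φ.1.1 ∂lam < 0 := by
  have hfix : ∀ t : ℝ, ¬ ∀ᵐ φ : AffP ∂lam, φ.1.1 * t + φ.1.2 = t := fun t ht =>
    hnofix ⟨t, forall_mem_msupport_of_ae (isClosed_eq (by fun_prop) (by fun_prop)) ht⟩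
  by_contra! hdrift
  refine hfix 0 ?_
  filter_upwards [ae_charFun_eq_of_drift_nonneg hσ hlog hdrift] with φ hφ
  have := eq_id_of_charFun_eq φ.2
    (fun ⟨y, hy⟩ => hfix y (ae_fixes_of_singleton_eq_one hσ hy)) hφ
  simp [this.2]

end Drift

section Contraction

open ProbabilityTheory in
theorem exists_integral_rpow_lt_one {lam : Measure AffP} [IsProbabilityMeasure lam] {ε : ℝ}
    (hε : 0 < ε) (hp : Integrable (fun φ : AffP => φ.1.1 ^ ε) lam)
    (hm : Integrable (fun φ : AffP => φ.1.1 ^ (-ε)) lam)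
    (hdrift : Integrable (fun φ : AffP => Real.log φ.1.1) lam →
      ∫ φ : AffP, Real.log φ.1.1 ∂lam < 0) {η : ℝ} (hη : 0 < η) :
    ∃ δ : ℝ, 0 < δ ∧ δ < η ∧ Integrable (fun φ : AffP => φ.1.1 ^ δ) lam ∧
      ∫ φ : AffP, φ.1.1 ^ δ ∂lam < 1 := by
  set X : AffP → ℝ := fun φ => Real.log φ.1.1 with hX
  have hrpow : ∀ t : ℝ, (fun φ : AffP => φ.1.1 ^ t) = fun φ => Real.exp (t * X φ) := fun t => by
    funext φ
    rw [Real.rpow_def_of_pos φ.2, mul_comm]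
  have hsub : Set.Icc (-ε) ε ⊆ integrableExpSet X lam := fun t ht => by
    rw [hrpow] at hp hm
    exact integrable_exp_mul_of_le_of_le hm hp ht.1 ht.2
  have h0 : (0 : ℝ) ∈ interior (integrableExpSet X lam) :=
    interior_mono hsub (by rw [interior_Icc]; exact ⟨neg_neg_of_pos hε, hε⟩)
  have hneg := hdrift (integrable_of_mem_interior_integrableExpSet h0)
  have hder : HasDerivAt (mgf X lam) (∫ φ, X φ ∂lam) 0 := by
    simpa using hasDerivAt_mgf h0
  have hslope := (hasDerivAt_iff_tendsto_slope.1 hder).mono_left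
    (nhdsWithin_mono 0 (fun x (hx : 0 < x) => hx.ne'))
  have hev : ∀ᶠ t in 𝓝[>] (0 : ℝ), slope (mgf X lam) 0 t < 0 :=
    hslope.eventually (gt_mem_nhds hneg)
  obtain ⟨δ, hδ, hδ0, hδη⟩ :=
    (hev.and (Ioo_mem_nhdsGT (lt_min hη hε))).exists
  refine ⟨δ, hδ0, hδη.trans_le (min_le_left _ _), ?_, ?_⟩
  · rw [hrpow]
    exact hsub ⟨by linarith, (hδη.trans_le (min_le_right _ _)).le⟩
  · rw [hrpow]
    rw [slope_def_field, mgf_zero, sub_zero, div_neg_iff] at hδ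
    have h1 : mgf X lam δ < 1 := by
      rcases hδ with h | h
      · linarith [h.2]
      · linarith [h.1]
    exact h1

theorem exists_contracting_exponent {lam : Measure AffP} [IsProbabilityMeasure lam]
    (hmom : ∃ ε : ℝ, 0 < ε ∧
      ∫⁻ φ : AffP, ENNReal.ofReal (φ.1.1 ^ ε + φ.1.1 ^ (-ε) + |φ.1.2| ^ ε) ∂lam < ⊤)
    (hdrift : Integrable (fun φ : AffP => Real.log φ.1.1) lam →
      ∫ φ : AffP, Real.log φ.1.1 ∂lam < 0) :
    ∃ δ : ℝ, 0 < δ ∧ δ ≤ 1 ∧ Integrable (fun φ : AffP => |φ.1.2| ^ δ) lam ∧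
      Integrable (fun φ : AffP => φ.1.1 ^ δ) lam ∧ ∫ φ : AffP, φ.1.1 ^ δ ∂lam < 1 := by
  obtain ⟨ε, hε, hlt⟩ := hmom
  have hr : ∀ (φ : AffP) (t : ℝ), 0 ≤ φ.1.1 ^ t := fun φ t => Real.rpow_nonneg φ.2.le t
  have hb : ∀ (φ : AffP) (t : ℝ), 0 ≤ |φ.1.2| ^ t := fun φ t =>
    Real.rpow_nonneg (abs_nonneg _) t
  have hsum : Integrable (fun φ : AffP => φ.1.1 ^ ε + φ.1.1 ^ (-ε) + |φ.1.2| ^ ε) lam := by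
    refine ⟨Measurable.aestronglyMeasurable (by fun_prop), ?_⟩
    rw [hasFiniteIntegral_iff_ofReal (Eventually.of_forall fun φ => ?_)]
    · exact hlt
    · exact add_nonneg (add_nonneg (hr _ _) (hr _ _)) (hb _ _)
  have hp : Integrable (fun φ : AffP => φ.1.1 ^ ε) lam :=
    hsum.mono' (Measurable.aestronglyMeasurable (by fun_prop)) (Eventually.of_forall fun φ => by
      rw [Real.norm_of_nonneg (hr _ _)]
      linarith [hr φ (-ε), hb φ ε])
  have hm : Integrable (fun φ : AffP => φ.1.1 ^ (-ε)) lam :=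
    hsum.mono' (Measurable.aestronglyMeasurable (by fun_prop)) (Eventually.of_forall fun φ => by
      rw [Real.norm_of_nonneg (hr _ _)]
      linarith [hr φ ε, hb φ ε])
  obtain ⟨δ, hδ0, hδ, hi, hlt1⟩ :=
    exists_integral_rpow_lt_one hε hp hm hdrift (lt_min one_pos hε)
  refine ⟨δ, hδ0, (hδ.trans_le (min_le_left _ _)).le, ?_, hi, hlt1⟩
  refine (hsum.add (integrable_const 1)).mono' (Measurable.aestronglyMeasurable (by fun_prop))
    (Eventually.of_forall fun φ => ?_)
  rw [Real.norm_of_nonneg (hb _ _)]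
  have hle : |φ.1.2| ^ δ ≤ |φ.1.2| ^ ε + 1 := by
    rcases le_total |φ.1.2| 1 with h | h
    · linarith [Real.rpow_le_one (abs_nonneg _) h hδ0.le, hb φ ε]
    · linarith [Real.rpow_le_rpow_of_exponent_le h (hδ.trans_le (min_le_right 1 ε)).le]
  simp only [Pi.add_apply]
  linarith [hr φ ε, hr φ (-ε)]

/-- The Markov operator associated with `lam`. -/
noncomputable def markovOp (lam : Measure AffP) (f : ℝ → ℝ) (x : ℝ) : ℝ :=
  ∫ φ : AffP, f (φ.1.1 * x + φ.1.2) ∂lam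

/-- Continuous functions bounded by `B` which are `δ`-Hölder with constant `H`. -/
structure IsBoundedHolder (δ B H : ℝ) (f : ℝ → ℝ) : Prop where
  continuous : Continuous f
  abs_le : ∀ x, |f x| ≤ B
  abs_sub_le : ∀ x y, |f x - f y| ≤ H * |x - y| ^ δ

theorem IsBoundedHolder.of_lipschitzWith {f : ℝ → ℝ} {B δ : ℝ} {K : NNReal}
    (hB : ∀ x, |f x| ≤ B) (hK : LipschitzWith K f) (hδ0 : 0 < δ) (hδ1 : δ ≤ 1) :
    IsBoundedHolder δ B (2 * (B + K)) f := by
  refine ⟨hK.continuous, hB, fun x y => ?_⟩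
  have hB0 : 0 ≤ B := (abs_nonneg _).trans (hB 0)
  have hlip : |f x - f y| ≤ K * |x - y| := by simpa [Real.dist_eq] using hK.dist_le_mul x y
  have hbd : |f x - f y| ≤ 2 * B := by linarith [abs_sub (f x) (f y), hB x, hB y]
  have hK0 : (0 : ℝ) ≤ K := K.2
  rcases le_total |x - y| 1 with h | h
  · have h1 : |x - y| ≤ |x - y| ^ δ := by
      simpa using Real.rpow_le_rpow_of_exponent_ge' (abs_nonneg (x - y)) h hδ0.le hδ1
    have h2 : 0 ≤ |x - y| ^ δ := (abs_nonneg _).trans h1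
    calc |f x - f y| ≤ K * |x - y| := hlip
      _ ≤ K * |x - y| ^ δ := by gcongr
      _ ≤ 2 * (B + K) * |x - y| ^ δ := by gcongr; linarith
  · have h1 : 1 ≤ |x - y| ^ δ := Real.one_le_rpow h hδ0.le
    nlinarith

variable {lam : Measure AffP} [IsProbabilityMeasure lam] {δ B H : ℝ} {f : ℝ → ℝ}

theorem IsBoundedHolder.integrable {Ω : Type*} [MeasurableSpace Ω] {P : Measure Ω}
    [IsFiniteMeasure P] (hf : IsBoundedHolder δ B H f) {g : Ω → ℝ} (hg : Measurable g) :
    Integrable (fun ω => f (g ω)) P :=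
  Integrable.of_bound (hf.continuous.measurable.comp hg).aestronglyMeasurable B
    (Eventually.of_forall fun ω => hf.abs_le (g ω))

theorem IsBoundedHolder.map_markovOp (hf : IsBoundedHolder δ B H f)
    (hr : Integrable (fun φ : AffP => φ.1.1 ^ δ) lam) :
    IsBoundedHolder δ B (H * ∫ φ : AffP, φ.1.1 ^ δ ∂lam) (markovOp lam f) where
  continuous := by
    have hc := hf.continuous
    refine continuous_of_dominated (bound := fun _ => B)
      (fun x => (hf.integrable (by fun_prop)).aestronglyMeasurable)
      (fun x => Eventually.of_forall fun φ => hf.abs_le _) (integrable_const _)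
      (Eventually.of_forall fun φ => by fun_prop)
  abs_le x := by
    simpa [markovOp] using norm_integral_le_of_norm_le_const (μ := lam)
      (f := fun φ : AffP => f (φ.1.1 * x + φ.1.2))
      (Eventually.of_forall fun φ => hf.abs_le (φ.1.1 * x + φ.1.2))
  abs_sub_le x y := by
    unfold markovOp
    rw [← integral_sub (hf.integrable (by fun_prop)) (hf.integrable (by fun_prop)), mul_assoc,
      ← integral_mul_const, ← integral_const_mul, ← Real.norm_eq_abs]
    refine norm_integral_le_of_norm_le ((hr.mul_const _).const_mul _)
      (Eventually.of_forall fun φ => ?_)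
    refine (hf.abs_sub_le _ _).trans_eq ?_
    rw [show φ.1.1 * x + φ.1.2 - (φ.1.1 * y + φ.1.2) = φ.1.1 * (x - y) by ring, abs_mul,
      abs_of_pos φ.2, Real.mul_rpow φ.2.le (abs_nonneg _)]

theorem IsBoundedHolder.integral_markovOp (hf : IsBoundedHolder δ B H f)
    {μ ν : Measure ℝ} [IsProbabilityMeasure μ]
    (hν : ν = (lam.prod μ).map (fun p : AffP × ℝ => p.1.1.1 * p.2 + p.1.1.2)) :
    ∫ x, f x ∂ν = ∫ x, markovOp lam f x ∂μ := by
  rw [hν, integral_map measurable_affine_action.aemeasurable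
    hf.continuous.aestronglyMeasurable,
    integral_prod_symm _ (hf.integrable measurable_affine_action)]
  rfl

instance isProbabilityMeasure_iterLaw (n : ℕ) : IsProbabilityMeasure (iterLaw lam n) := by
  induction n with
  | zero => exact Measure.dirac.isProbabilityMeasure
  | succ n ih => exact Measure.isProbabilityMeasure_map measurable_affine_action.aemeasurable

theorem dist_integral_iterLaw_succ_le (hf : IsBoundedHolder δ B H f)
    (hr : Integrable (fun φ : AffP => φ.1.1 ^ δ) lam)
    (hb : Integrable (fun φ : AffP => |φ.1.2| ^ δ) lam) (n : ℕ) :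
    |(∫ x, f x ∂(iterLaw lam n)) - ∫ x, f x ∂(iterLaw lam (n + 1))| ≤
      H * (∫ φ : AffP, |φ.1.2| ^ δ ∂lam) * (∫ φ : AffP, φ.1.1 ^ δ ∂lam) ^ n := by
  induction n generalizing f H with
  | zero =>
    rw [hf.integral_markovOp (ν := iterLaw lam (0 + 1)) rfl]
    have h1 : (∫ x, f x ∂(iterLaw lam 0)) - ∫ x, markovOp lam f x ∂(iterLaw lam 0) =
        ∫ φ : AffP, (f 0 - f φ.1.2) ∂lam := by
      simp only [iterLaw, integral_dirac, markovOp, mul_zero, zero_add]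
      rw [integral_sub (integrable_const _) (hf.integrable (by fun_prop))]
      simp
    rw [h1, pow_zero, mul_one, ← integral_const_mul, ← Real.norm_eq_abs]
    refine norm_integral_le_of_norm_le (hb.const_mul _) (Eventually.of_forall fun φ => ?_)
    simpa using hf.abs_sub_le 0 φ.1.2
  | succ n ih =>
    rw [hf.integral_markovOp (ν := iterLaw lam (n + 1 + 1)) rfl,
      hf.integral_markovOp (ν := iterLaw lam (n + 1)) rfl]
    refine (ih (hf.map_markovOp hr)).trans_eq ?_
    ring

variable {σ : Measure ℝ} [IsProbabilityMeasure σ]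

theorem dist_integral_iterLaw_stationary_le (hf : IsBoundedHolder δ B H f)
    (hr : Integrable (fun φ : AffP => φ.1.1 ^ δ) lam)
    (hσ : σ = (lam.prod σ).map (fun p : AffP × ℝ => p.1.1.1 * p.2 + p.1.1.2)) (n : ℕ) :
    |(∫ x, f x ∂(iterLaw lam n)) - ∫ x, f x ∂σ| ≤
      ∫ x, min (2 * B) (H * (∫ φ : AffP, φ.1.1 ^ δ ∂lam) ^ n * |x| ^ δ) ∂σ := by
  induction n generalizing f H with
  | zero =>
    have h1 : (∫ x, f x ∂(iterLaw lam 0)) - ∫ x, f x ∂σ = ∫ x, (f 0 - f x) ∂σ := by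
      rw [integral_sub (integrable_const _) (hf.integrable (g := fun x => x) measurable_id)]
      simp [iterLaw]
    have h2 : ∀ x, |f 0 - f x| ≤ min (2 * B) (H * |x| ^ δ) := fun x => by
      refine le_min ?_ (by simpa using hf.abs_sub_le 0 x)
      linarith [abs_sub (f 0) (f x), hf.abs_le 0, hf.abs_le x]
    rw [h1, pow_zero, mul_one, ← Real.norm_eq_abs]
    refine norm_integral_le_of_norm_le ?_ (Eventually.of_forall h2)
    refine Integrable.of_bound (C := 2 * B) (Measurable.aestronglyMeasurable (by fun_prop))
      (Eventually.of_forall fun x => ?_)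
    rw [Real.norm_of_nonneg ((abs_nonneg _).trans (h2 x))]
    exact min_le_left _ _
  | succ n ih =>
    rw [hf.integral_markovOp (ν := iterLaw lam (n + 1)) rfl, hf.integral_markovOp hσ]
    refine (ih (hf.map_markovOp hr)).trans_eq ?_
    ring_nf

theorem tendsto_integral_iterLaw (hf : IsBoundedHolder δ B H f) (hH : 0 ≤ H)
    (hr : Integrable (fun φ : AffP => φ.1.1 ^ δ) lam) (hr1 : ∫ φ : AffP, φ.1.1 ^ δ ∂lam < 1)
    (hσ : σ = (lam.prod σ).map (fun p : AffP × ℝ => p.1.1.1 * p.2 + p.1.1.2)) :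
    Tendsto (fun n => ∫ x, f x ∂(iterLaw lam n)) atTop (𝓝 (∫ x, f x ∂σ)) := by
  have hρ0 : 0 ≤ ∫ φ : AffP, φ.1.1 ^ δ ∂lam :=
    integral_nonneg fun φ => Real.rpow_nonneg φ.2.le _
  have hB0 : 0 ≤ B := (abs_nonneg _).trans (hf.abs_le 0)
  set ρ := ∫ φ : AffP, φ.1.1 ^ δ ∂lam
  rw [tendsto_iff_dist_tendsto_zero]
  refine squeeze_zero (fun n => dist_nonneg)
    (dist_integral_iterLaw_stationary_le hf hr hσ) ?_
  suffices h : Tendsto (fun n : ℕ => ∫ x, min (2 * B) (H * ρ ^ n * |x| ^ δ) ∂σ) atTop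
      (𝓝 (∫ _, (0 : ℝ) ∂σ)) by simpa using h
  refine tendsto_integral_of_dominated_convergence (fun _ => 2 * B)
    (fun n => Measurable.aestronglyMeasurable (by fun_prop)) (integrable_const _)
    (fun n => Eventually.of_forall fun x => ?_) (Eventually.of_forall fun x => ?_)
  · have h1 : 0 ≤ H * ρ ^ n * |x| ^ δ := by positivity
    rw [Real.norm_of_nonneg (le_min (by linarith) h1)]
    exact min_le_left _ _
  · have h1 : Tendsto (fun n : ℕ => H * ρ ^ n * |x| ^ δ) atTop (𝓝 0) := by
      simpa using ((tendsto_pow_atTop_nhds_zero_of_lt_one hρ0 hr1).const_mul H).mul_const _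
    have h2 := (tendsto_const_nhds (x := 2 * B)).min h1
    rwa [min_eq_right (by linarith)] at h2

theorem abs_integral_iterLaw_sub_le (hf : IsBoundedHolder δ B H f) (hH : 0 ≤ H)
    (hr : Integrable (fun φ : AffP => φ.1.1 ^ δ) lam)
    (hb : Integrable (fun φ : AffP => |φ.1.2| ^ δ) lam)
    (hr1 : ∫ φ : AffP, φ.1.1 ^ δ ∂lam < 1)
    (hσ : σ = (lam.prod σ).map (fun p : AffP × ℝ => p.1.1.1 * p.2 + p.1.1.2)) (n : ℕ) :
    |(∫ x, f x ∂(iterLaw lam n)) - ∫ x, f x ∂σ| ≤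
      H * (∫ φ : AffP, |φ.1.2| ^ δ ∂lam) * (∫ φ : AffP, φ.1.1 ^ δ ∂lam) ^ n /
        (1 - ∫ φ : AffP, φ.1.1 ^ δ ∂lam) :=
  dist_le_of_le_geometric_of_tendsto _ _ hr1 (dist_integral_iterLaw_succ_le hf hr hb)
    (tendsto_integral_iterLaw hf hH hr hr1 hσ) n

end Contraction

/-- Exponentially fast convergence of `σ⁽ⁿ⁾` to `σ` against bounded Lipschitz functions. -/
theorem iterLaw_tendsto_stationary_exponential
    (lam : Measure AffP) [IsProbabilityMeasure lam]
    (hmom : ∃ ε : ℝ, 0 < ε ∧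
      ∫⁻ φ : AffP, ENNReal.ofReal (φ.1.1 ^ ε + φ.1.1 ^ (-ε) + |φ.1.2| ^ ε) ∂lam < ⊤)
    (hnofix : ¬ ∃ t : ℝ, ∀ φ ∈ msupport lam, φ.1.1 * t + φ.1.2 = t)
    (σ : Measure ℝ) [IsProbabilityMeasure σ]
    (hstat : ∀ A : Set ℝ, MeasurableSet A →
      σ A = ∫⁻ φ : AffP, σ ((fun t => φ.1.1 * t + φ.1.2) ⁻¹' A) ∂lam) :
    ∃ ε : ℝ, 0 < ε ∧ ∃ C : ℝ, 0 < C ∧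
      ∀ n : ℕ, ∀ f : ℝ → ℝ, ∀ B : ℝ, ∀ K : NNReal,
        (∀ s, |f s| ≤ B) → LipschitzWith K f →
        |(∫ s, f s ∂(iterLaw lam n)) - ∫ s, f s ∂σ| ≤
          C * Real.exp (-ε * n) * (B + K) := by
  have hσ := eq_map_of_stationary hstat
  obtain ⟨δ, hδ0, hδ1, hb, hr, hr1⟩ :=
    exists_contracting_exponent hmom (integral_log_neg_of_stationary hσ hnofix)
  have hβ0 : 0 ≤ ∫ φ : AffP, |φ.1.2| ^ δ ∂lam :=
    integral_nonneg fun φ => Real.rpow_nonneg (abs_nonneg _) _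
  have hρ0 : 0 < ∫ φ : AffP, φ.1.1 ^ δ ∂lam := by
    rw [integral_pos_iff_support_of_nonneg (fun φ => Real.rpow_nonneg φ.2.le _) hr,
      Function.support_eq_univ fun φ => (Real.rpow_pos_of_pos φ.2 _).ne']
    simp
  set β := ∫ φ : AffP, |φ.1.2| ^ δ ∂lam with hβ
  set ρ := ∫ φ : AffP, φ.1.1 ^ δ ∂lam with hρ
  have h1ρ : 0 < 1 - ρ := by linarith
  refine ⟨-Real.log ρ, neg_pos.2 (Real.log_neg hρ0 hr1), 2 * β / (1 - ρ) + 1, by positivity, ?_⟩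
  intro n f B K hB hK
  have hB0 : 0 ≤ B := (abs_nonneg _).trans (hB 0)
  have hf := IsBoundedHolder.of_lipschitzWith hB hK hδ0 hδ1
  refine (abs_integral_iterLaw_sub_le hf (by positivity) hr hb hr1 hσ n).trans ?_
  have hexp : Real.exp (-(-Real.log ρ) * n) = ρ ^ n := by
    rw [neg_neg, mul_comm, Real.exp_nat_mul, Real.exp_log hρ0]
  rw [hexp, ← hβ, ← hρ]
  have hnn : 0 ≤ ρ ^ n * (B + K) := by positivity
  calc 2 * (B + K) * β * ρ ^ n / (1 - ρ) = 2 * β / (1 - ρ) * (ρ ^ n * (B + K)) := by ring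
    _ ≤ (2 * β / (1 - ρ) + 1) * (ρ ^ n * (B + K)) := by gcongr; linarith
    _ = (2 * β / (1 - ρ) + 1) * ρ ^ n * (B + K) := by ring
end
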